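/- arXiv:2406.17765 — 3 statements merged into one kernel-verified Lean document; each statement's English description precedes it below -/
import Mathlib

section
/- Let W be an irreducible Weyl group of Cartan type A_n, B_n, or C_n and let J ⊂ S be any subset of the simple reflections. Then there exists x ∈ ^J W such that x ≤ x·w₀ in the Bruhat order and ℓ(x) = ½[(ℓ(w₀) − ℓ_R(w₀)) − (ℓ(w_J) − ℓ_R(w_J))]. -/
open scoped Classical

namespace CoxeterSystem

variable {B : Type*} {W : Type*} [Group W] {M : CoxeterMatrix B} (cs : CoxeterSystem M W)

/-- The Bruhat order on a Coxeter group: `x ≤ y` iff `y` can be obtained from `x` by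
successively multiplying on the right by reflections, each multiplication strictly
increasing the length. -/
def bruhatLE (x y : W) : Prop :=
  Relation.ReflTransGen
    (fun a b => (∃ t, cs.IsReflection t ∧ b = a * t) ∧ cs.length a < cs.length b) x y

/-- the reflection length `ℓ_R(w)` : the minimal number of reflections whose product
is `w` -/
noncomputable def reflLen (w : W) : ℕ :=
  sInf {n | ∃ l : List W, l.length = n ∧ (∀ t ∈ l, cs.IsReflection t) ∧ l.prod = w}

/-- the standard parabolic subgroup `W_K` generated by the simple reflections in `K` -/
def parabolic (K : Set B) : Subgroup W := Subgroup.closure (cs.simple '' K)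

/-- `w` is the longest element of the standard parabolic subgroup `W_K` -/
def IsLongestOf (K : Set B) (w : W) : Prop :=
  w ∈ cs.parabolic K ∧ ∀ u ∈ cs.parabolic K, cs.length u ≤ cs.length w

/-- `w` is a minimal length representative of its coset in `W_K \ W` -/
def IsMinRep (K : Set B) (w : W) : Prop :=
  ∀ u ∈ cs.parabolic K, cs.length w ≤ cs.length (u * w)

end CoxeterSystem

open scoped InnerProductSpace

section RootReflection

variable {V : Type*} [NormedAddCommGroup V] [InnerProductSpace ℝ V]

/-- The orthogonal reflection in the hyperplane orthogonal to `γ` (the identity if `γ = 0`). -/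
noncomputable def rootRefl (γ : V) : Module.End ℝ V :=
  LinearMap.id - ((2 / ⟪γ, γ⟫_ℝ) • (innerₛₗ ℝ γ)).smulRight γ

theorem rootRefl_apply (γ v : V) : rootRefl γ v = v - (2 / ⟪γ, γ⟫_ℝ * ⟪γ, v⟫_ℝ) • γ := by
  simp [rootRefl]

theorem rootRefl_self (γ : V) : rootRefl γ γ = -γ := by
  rcases eq_or_ne γ 0 with rfl | h
  · simp
  · have : ⟪γ, γ⟫_ℝ ≠ 0 := inner_self_ne_zero.2 h
    rw [rootRefl_apply, div_mul_cancel₀ _ this]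
    module

theorem rootRefl_of_inner_eq_zero {γ v : V} (h : ⟪γ, v⟫_ℝ = 0) : rootRefl γ v = v := by
  simp [rootRefl_apply, h]

theorem inner_rootRefl_rootRefl (γ u v : V) : ⟪rootRefl γ u, rootRefl γ v⟫_ℝ = ⟪u, v⟫_ℝ := by
  rcases eq_or_ne γ 0 with rfl | h
  · simp [rootRefl_apply]
  · have : ⟪γ, γ⟫_ℝ ≠ 0 := inner_self_ne_zero.2 h
    simp only [rootRefl_apply, inner_sub_left, inner_sub_right, inner_smul_left, inner_smul_right,
      real_inner_comm γ u, RCLike.conj_to_real]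
    field_simp
    ring

theorem rootRefl_mul_self (γ : V) : rootRefl γ * rootRefl γ = 1 := by
  ext v
  rw [Module.End.mul_apply, rootRefl_apply γ v, map_sub, map_smul, rootRefl_self, rootRefl_apply]
  simp

theorem map_rootRefl {f : Module.End ℝ V} (hf : ∀ u v, ⟪f u, f v⟫_ℝ = ⟪u, v⟫_ℝ) (γ v : V) :
    f (rootRefl γ v) = rootRefl (f γ) (f v) := by
  simp only [rootRefl_apply, map_sub, map_smul, hf]

/-- The product of the reflections in pairwise orthogonal vectors is `-1` on their span. -/
theorem prod_rootRefl_apply_of_mem_span {L : List V} (hL : L.Pairwise (⟪·, ·⟫_ℝ = 0)) {v : V}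
    (hv : v ∈ Submodule.span ℝ {γ | γ ∈ L}) : (L.map rootRefl).prod v = -v := by
  have hfix : ∀ (L : List V) (u : V), (∀ γ ∈ L, ⟪γ, u⟫_ℝ = 0) → (L.map rootRefl).prod u = u := by
    intro L u
    induction L with
    | nil => simp
    | cons γ L ih =>
      intro h
      simp only [List.mem_cons, forall_eq_or_imp] at h
      rw [List.map_cons, List.prod_cons, Module.End.mul_apply, ih h.2,
        rootRefl_of_inner_eq_zero h.1]
  induction hv using Submodule.span_induction with
  | zero => simp
  | add u v _ _ hu hv => rw [map_add, hu, hv]; abel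
  | smul c u _ hu => rw [map_smul, hu, smul_neg]
  | mem u hu =>
    induction L with
    | nil => simp at hu
    | cons γ L ih =>
      rw [List.pairwise_cons] at hL
      rw [List.map_cons, List.prod_cons, Module.End.mul_apply]
      rcases List.mem_cons.1 hu with rfl | hu
      · rw [hfix L u fun η hη ↦ by rw [real_inner_comm]; exact hL.1 η hη, rootRefl_self]
      · rw [ih hL.2 hu, map_neg, rootRefl_of_inner_eq_zero (hL.1 u hu)]

/-- A product of reflections moves every vector by a combination of their roots. -/
theorem prod_rootRefl_sub_mem_span (L : List V) (v : V) :
    (L.map rootRefl).prod v - v ∈ Submodule.span ℝ {γ | γ ∈ L} := by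
  induction L with
  | nil => simp
  | cons γ L ih =>
    rw [List.map_cons, List.prod_cons, Module.End.mul_apply, rootRefl_apply, sub_right_comm]
    refine sub_mem (Submodule.span_mono (fun η hη ↦ List.mem_cons_of_mem _ hη) ih) ?_
    exact Submodule.smul_mem _ _ (Submodule.subset_span List.mem_cons_self)

/-- A product of reflections in `k` pairwise orthogonal nonzero vectors is not a product of fewer
than `k` reflections. -/
theorem length_le_of_prod_rootRefl_eq {L L' : List V} (hL : L.Pairwise (⟪·, ·⟫_ℝ = 0))
    (h0 : ∀ γ ∈ L, γ ≠ 0) (h : (L.map rootRefl).prod = (L'.map rootRefl).prod) :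
    L.length ≤ L'.length := by
  have hfin : FiniteDimensional ℝ (Submodule.span ℝ {γ | γ ∈ L'}) :=
    FiniteDimensional.span_of_finite ℝ L'.finite_toSet
  have hmem : ∀ γ ∈ L, γ ∈ Submodule.span ℝ {γ | γ ∈ L'} := by
    intro γ hγ
    have h1 := prod_rootRefl_sub_mem_span L' γ
    rw [← h, prod_rootRefl_apply_of_mem_span hL (Submodule.subset_span hγ)] at h1
    have h2 := Submodule.smul_mem _ (-(1 / 2) : ℝ) h1
    convert h2 using 1
    module
  have hind : LinearIndependent ℝ (fun i : Fin L.length ↦ L.get i) := by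
    refine linearIndependent_of_ne_zero_of_inner_eq_zero (fun i ↦ h0 _ (L.get_mem i)) ?_
    intro i j hij
    rcases lt_or_gt_of_ne hij with hlt | hlt
    · exact List.pairwise_iff_get.1 hL i j hlt
    · show ⟪L.get i, L.get j⟫_ℝ = 0
      rw [real_inner_comm]
      exact List.pairwise_iff_get.1 hL j i hlt
  have h1 : Module.finrank ℝ (Submodule.span ℝ (Set.range fun i : Fin L.length ↦ L.get i))
      = L.length := by
    rw [finrank_span_eq_card hind, Fintype.card_fin]
  have h2 : Submodule.span ℝ (Set.range fun i : Fin L.length ↦ L.get i)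
      ≤ Submodule.span ℝ {γ | γ ∈ L'} := by
    rw [Submodule.span_le]
    rintro _ ⟨i, rfl⟩
    exact hmem _ (L.get_mem i)
  have h3 : Module.finrank ℝ (Submodule.span ℝ {γ | γ ∈ L'}) ≤ L'.length := by
    have := finrank_span_finset_le_card (R := ℝ) L'.toFinset
    simp only [List.coe_toFinset] at this
    exact this.trans L'.toFinset_card_le
  exact h1 ▸ (Submodule.finrank_mono h2).trans h3

end RootReflection

/-- A system of positive roots in a Euclidean space realizing the Coxeter matrix `M`, all of whose
entries are at most `4`. -/
structure PositiveSystem {B : Type*} (M : CoxeterMatrix B) (V : Type*) [NormedAddCommGroup V]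
    [InnerProductSpace ℝ V] where
  /-- The simple roots. -/
  root : B → V
  /-- The positive roots. -/
  pos : Finset V
  /-- A vector in the open fundamental chamber. -/
  rho : V
  root_mem : ∀ i, root i ∈ pos
  rho_pos : ∀ γ ∈ pos, 0 < ⟪rho, γ⟫_ℝ
  rootRefl_mem : ∀ i, ∀ γ ∈ pos, γ ≠ root i → rootRefl (root i) γ ∈ pos
  inner_pos : ∀ u : V, (∀ i, 0 < ⟪u, root i⟫_ℝ) → ∀ γ ∈ pos, 0 < ⟪u, γ⟫_ℝ
  rank_two : ∀ i j, i ≠ j → ∃ a b : ℝ, rootRefl (root i) (root j) = root j + a • root i ∧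
    rootRefl (root j) (root i) = root i + b • root j ∧
    (M i j = 2 ∧ a = 0 ∧ b = 0 ∨ M i j = 3 ∧ a = 1 ∧ b = 1 ∨
      M i j = 4 ∧ 0 < a ∧ 0 < b ∧ a * b = 2)

namespace PositiveSystem

variable {B W V : Type*} [Group W] {M : CoxeterMatrix B} (cs : CoxeterSystem M W)
  [NormedAddCommGroup V] [InnerProductSpace ℝ V] (R : PositiveSystem M V)

theorem ne_zero {γ : V} (hγ : γ ∈ R.pos) : γ ≠ 0 := by
  rintro rfl
  simpa using R.rho_pos 0 hγ

theorem isLiftable : M.IsLiftable (fun i ↦ rootRefl (R.root i)) := by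
  intro i j
  rcases eq_or_ne i j with rfl | hij
  · simp [rootRefl_mul_self]
  obtain ⟨a, b, ha, hb, h⟩ := R.rank_two i j hij
  obtain ⟨f, hf⟩ : ∃ f : V → ℝ, ∀ v, rootRefl (R.root i) v = v + f v • R.root i :=
    ⟨_, fun v ↦ by rw [rootRefl_apply, sub_eq_add_neg, ← neg_smul]⟩
  obtain ⟨g, hg⟩ : ∃ g : V → ℝ, ∀ v, rootRefl (R.root j) v = v + g v • R.root j :=
    ⟨_, fun v ↦ by rw [rootRefl_apply, sub_eq_add_neg, ← neg_smul]⟩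
  have hi := rootRefl_self (R.root i)
  have hj := rootRefl_self (R.root j)
  change (rootRefl (R.root i) * rootRefl (R.root j)) ^ M i j = 1
  ext v
  have hiv := hf v
  have hjv := hg v
  generalize rootRefl (R.root i) = S at *
  generalize rootRefl (R.root j) = T at *
  rcases h with ⟨hm, rfl, rfl⟩ | ⟨hm, rfl, rfl⟩ | ⟨hm, -, -, hab⟩
  · simp only [hm, pow_succ, pow_zero, one_mul, Module.End.mul_apply, Module.End.one_apply, hiv,
      hjv, map_add, map_smul, ha, hb, hi, hj, zero_smul, add_zero, map_neg]
    module
  · simp only [hm, pow_succ, pow_zero, one_mul, Module.End.mul_apply, Module.End.one_apply, hiv,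
      hjv, map_add, map_smul, ha, hb, hi, hj, map_neg]
    module
  · have hb0 : a ≠ 0 := by rintro rfl; simp at hab
    obtain rfl : b = 2 / a := by field_simp; linarith
    simp only [hm, pow_succ, pow_zero, one_mul, Module.End.mul_apply, Module.End.one_apply, hiv,
      hjv, map_add, map_smul, ha, hb, hi, hj, map_neg]
    match_scalars <;> field_simp <;> ring

/-- The reflection representation. -/
noncomputable def rep : W →* Module.End ℝ V := cs.lift ⟨_, R.isLiftable⟩

theorem rep_simple (i : B) : R.rep cs (cs.simple i) = rootRefl (R.root i) :=
  cs.lift_apply_simple R.isLiftable i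

theorem inner_rep_rep (w : W) (u v : V) : ⟪R.rep cs w u, R.rep cs w v⟫_ℝ = ⟪u, v⟫_ℝ := by
  induction w using cs.simple_induction_left with
  | one => simp
  | mul_simple_left w i ih =>
    rw [map_mul, rep_simple, Module.End.mul_apply, Module.End.mul_apply,
      inner_rootRefl_rootRefl, ih]

theorem rep_inv_rep (w : W) (v : V) : R.rep cs w⁻¹ (R.rep cs w v) = v := by
  rw [← Module.End.mul_apply, ← map_mul, inv_mul_cancel, map_one, Module.End.one_apply]

theorem rep_rep_inv (w : W) (v : V) : R.rep cs w (R.rep cs w⁻¹ v) = v := by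
  rw [← Module.End.mul_apply, ← map_mul, mul_inv_cancel, map_one, Module.End.one_apply]

theorem rep_injective (w : W) : Function.Injective (R.rep cs w) :=
  Function.LeftInverse.injective (R.rep_inv_rep cs w)

theorem inner_rep_left (w : W) (u v : V) : ⟪R.rep cs w u, v⟫_ℝ = ⟪u, R.rep cs w⁻¹ v⟫_ℝ := by
  rw [← R.inner_rep_rep cs w u, rep_rep_inv]

theorem rep_conj {t : W} {γ : V} (ht : R.rep cs t = rootRefl γ) (w : W) :
    R.rep cs (w * t * w⁻¹) = rootRefl (R.rep cs w γ) := by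
  ext v
  rw [map_mul, map_mul, ht, Module.End.mul_apply, Module.End.mul_apply,
    map_rootRefl (R.inner_rep_rep cs w), rep_rep_inv]

theorem rep_mem (w : W) {γ : V} (hγ : γ ∈ R.pos) :
    R.rep cs w γ ∈ R.pos ∨ -R.rep cs w γ ∈ R.pos := by
  induction w using cs.simple_induction_left with
  | one => simp [hγ]
  | mul_simple_left w i ih =>
    have key : ∀ η ∈ R.pos, rootRefl (R.root i) η ∈ R.pos ∨ -rootRefl (R.root i) η ∈ R.pos := by
      intro η hη
      by_cases h : η = R.root i
      · right
        rw [h, rootRefl_self, neg_neg]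
        exact R.root_mem i
      · exact Or.inl (R.rootRefl_mem i η hη h)
    rw [map_mul, rep_simple, Module.End.mul_apply]
    rcases ih with ih | ih
    · exact key _ ih
    · simpa [or_comm] using key _ ih

theorem mem_of_inner_rho_pos {w : W} {γ : V} (hγ : γ ∈ R.pos) (h : 0 < ⟪R.rho, R.rep cs w γ⟫_ℝ) :
    R.rep cs w γ ∈ R.pos := by
  refine (R.rep_mem cs w hγ).resolve_right fun h' ↦ ?_
  have := R.rho_pos _ h'
  rw [inner_neg_right] at this
  linarith

theorem neg_notMem {γ : V} (hγ : γ ∈ R.pos) : -γ ∉ R.pos := by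
  intro h
  have h1 := R.rho_pos _ h
  have h2 := R.rho_pos _ hγ
  rw [inner_neg_right] at h1
  linarith

theorem rep_root_mem_of_length_lt (w : W) (i : B)
    (h : cs.length w < cs.length (w * cs.simple i)) : R.rep cs w (R.root i) ∈ R.pos := by
  induction hk : cs.length w using Nat.strong_induction_on generalizing w i with
  | _ k ih =>
  subst hk
  rcases eq_or_ne w 1 with rfl | hw
  · simpa using R.root_mem i
  replace ih : ∀ v : W, cs.length v < cs.length w → ∀ i, cs.length v < cs.length (v * cs.simple i) →
      0 < ⟪R.rho, R.rep cs v (R.root i)⟫_ℝ :=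
    fun v hv i hi ↦ R.rho_pos _ (ih _ hv v i hi rfl)
  apply R.mem_of_inner_rho_pos cs (R.root_mem i)
  obtain ⟨j, hj⟩ := cs.exists_rightDescent_of_ne_one hw
  rw [cs.isRightDescent_iff] at hj
  have hij : i ≠ j := by
    rintro rfl
    omega
  obtain ⟨a, b, ha, hb, hm⟩ := R.rank_two i j hij
  have hii : cs.simple i * cs.simple i = 1 := cs.simple_mul_simple_self i
  have hjj : cs.simple j * cs.simple j = 1 := cs.simple_mul_simple_self j
  have hbr := cs.simple_mul_simple_pow i j
  have hfi := R.rep_simple cs i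
  have hfj := R.rep_simple cs j
  have hsi := rootRefl_self (R.root i)
  have hsj := rootRefl_self (R.root j)
  have hl : ∀ v k, cs.length (v * cs.simple k) ≤ cs.length v + 1 := fun v k ↦ by
    simpa using cs.length_mul_le v (cs.simple k)
  have hab : 0 ≤ a ∧ 0 ≤ b := by
    rcases hm with ⟨-, rfl, rfl⟩ | ⟨-, rfl, rfl⟩ | ⟨-, h1, h2, -⟩ <;> constructor <;> linarith
  -- peel off the longest alternating suffix in `s i` and `s j`
  obtain ⟨u, rfl⟩ : ∃ u, w = u * cs.simple j := ⟨w * cs.simple j, by simp⟩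
  rw [mul_assoc u, hjj, mul_one] at hj
  have huj := ih u (by omega) j (by omega)
  rcases cs.length_mul_simple u i with hui | hui
  · have hui := ih u (by omega) i (by omega)
    rw [map_mul, Module.End.mul_apply, hfj, hb, map_add, map_smul, inner_add_right,
      inner_smul_right]
    nlinarith
  obtain ⟨v, rfl⟩ : ∃ v, u = v * cs.simple i := ⟨u * cs.simple i, by simp⟩
  rw [mul_assoc v, hii, mul_one] at hui
  have hvi := ih v (by omega) i (by omega)
  rcases hm with ⟨hm, -, -⟩ | hm
  · exfalso
    have e : cs.simple i * cs.simple j * cs.simple i = cs.simple j := by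
      rw [hm, pow_two, ← mul_assoc] at hbr
      rw [eq_inv_of_mul_eq_one_left hbr, cs.inv_simple]
    have := hl v j
    rw [← e, ← mul_assoc, ← mul_assoc] at this
    omega
  rcases cs.length_mul_simple v j with hvj | hvj
  · have hvj := ih v (by omega) j (by omega)
    have hpos : 0 ≤ a * b - 1 ∧ 0 < b := by
      rcases hm with ⟨-, rfl, rfl⟩ | ⟨-, h1, h2, h3⟩ <;> constructor <;> linarith
    have : R.rep cs (v * cs.simple i * cs.simple j) (R.root i)
        = (a * b - 1) • R.rep cs v (R.root i) + b • R.rep cs v (R.root j) := by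
      simp only [map_mul, Module.End.mul_apply, hfi, hfj, hb, map_add, map_smul, hsi, ha, map_neg]
      module
    rw [this, inner_add_right, inner_smul_right, inner_smul_right]
    nlinarith [mul_nonneg hpos.1 hvi.le, mul_pos hpos.2 hvj]
  obtain ⟨x, rfl⟩ : ∃ x, v = x * cs.simple j := ⟨v * cs.simple j, by simp⟩
  rw [mul_assoc x, hjj, mul_one] at hvj
  rcases hm with ⟨hm, -, -⟩ | ⟨hm, h1, h2, h3⟩
  · exfalso
    have e : cs.simple j * cs.simple i * cs.simple j * cs.simple i
        = cs.simple i * cs.simple j := by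
      have hbr' := cs.simple_mul_simple_pow' i j
      rw [hm, pow_succ, pow_two] at hbr'
      rw [mul_assoc (cs.simple j * cs.simple i), eq_inv_of_mul_eq_one_left hbr', mul_inv_rev,
        cs.inv_simple, cs.inv_simple]
    have h1 := hl x i
    have h2 := hl (x * cs.simple i) j
    rw [mul_assoc, ← e] at h2
    simp only [← mul_assoc] at h2
    omega
  rcases cs.length_mul_simple x i with hxi | hxi
  · have hxi := ih x (by omega) i (by omega)
    have : R.rep cs (x * cs.simple j * cs.simple i * cs.simple j) (R.root i)
        = R.rep cs x (R.root i) := by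
      obtain rfl : b = 2 / a := by field_simp; linarith
      simp only [map_mul, Module.End.mul_apply, hfi, hfj, hb, map_add, map_smul, hsi, ha, map_neg,
        hsj]
      match_scalars <;> field_simp <;> ring
    rw [this]
    exact hxi
  obtain ⟨y, rfl⟩ : ∃ y, x = y * cs.simple i := ⟨x * cs.simple i, by simp⟩
  rw [mul_assoc y, hii, mul_one] at hxi
  exfalso
  have e : cs.simple i * cs.simple j * cs.simple i * cs.simple j * cs.simple i
      = cs.simple j * cs.simple i * cs.simple j := by
    rw [hm, show 4 = 2 + 2 from rfl, pow_add] at hbr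
    have := eq_inv_of_mul_eq_one_left hbr
    rw [pow_two, ← mul_assoc] at this
    rw [this]
    simp [mul_assoc]
  have h1 := hl y j
  have h2 := hl (y * cs.simple j) i
  have h3 := hl (y * cs.simple j * cs.simple i) j
  rw [mul_assoc y, mul_assoc y, ← e] at h3
  simp only [← mul_assoc] at h3
  omega

end PositiveSystem

namespace PositiveSystem

variable {B W V : Type*} [Group W] {M : CoxeterMatrix B} (cs : CoxeterSystem M W)
  [NormedAddCommGroup V] [InnerProductSpace ℝ V] (R : PositiveSystem M V)

theorem rep_mul_simple_root (w : W) (i : B) :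
    R.rep cs (w * cs.simple i) (R.root i) = -R.rep cs w (R.root i) := by
  rw [map_mul, rep_simple, Module.End.mul_apply, rootRefl_self, map_neg]

theorem rep_root_mem_iff (w : W) (i : B) :
    R.rep cs w (R.root i) ∈ R.pos ↔ cs.length w < cs.length (w * cs.simple i) := by
  refine ⟨fun h ↦ ?_, R.rep_root_mem_of_length_lt cs w i⟩
  by_contra hlt
  have h1 : cs.length (w * cs.simple i) < cs.length (w * cs.simple i * cs.simple i) := by
    rw [cs.simple_mul_simple_cancel_right]
    rcases cs.length_mul_simple w i with h | h <;> omega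
  have h2 := R.rep_root_mem_of_length_lt cs _ i h1
  rw [rep_mul_simple_root] at h2
  exact R.neg_notMem h h2

theorem eq_one_of_forall_rep_root_mem {w : W} (h : ∀ i, R.rep cs w (R.root i) ∈ R.pos) :
    w = 1 := by
  by_contra hw
  obtain ⟨i, hi⟩ := cs.exists_rightDescent_of_ne_one hw
  exact lt_asymm hi ((R.rep_root_mem_iff cs w i).1 (h i))

theorem eq_of_rep_eq {w w' : W} (h : R.rep cs w = R.rep cs w') : w = w' := by
  rw [← inv_mul_eq_one]
  refine R.eq_one_of_forall_rep_root_mem cs fun i ↦ ?_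
  rw [map_mul, ← h, Module.End.mul_apply, rep_inv_rep]
  exact R.root_mem i

theorem rootRefl_mem_of_mem (i : B) {γ : V} (hγ : γ ∈ R.pos) (h : γ ≠ R.root i) :
    rootRefl (R.root i) γ ∈ R.pos.erase (R.root i) := by
  refine Finset.mem_erase.2 ⟨fun h' ↦ ?_, R.rootRefl_mem i γ hγ h⟩
  have h2 : rootRefl (R.root i) (rootRefl (R.root i) γ) = γ := by
    rw [← Module.End.mul_apply, rootRefl_mul_self, Module.End.one_apply]
  rw [h', rootRefl_self] at h2
  exact R.neg_notMem (R.root_mem i) (h2 ▸ hγ)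

/-- A simple reflection permutes the positive roots other than its own root. -/
theorem card_filter_rootRefl (i : B) (p : V → Prop) [DecidablePred p] :
    ((R.pos.erase (R.root i)).filter fun γ ↦ p (rootRefl (R.root i) γ)).card
      = ((R.pos.erase (R.root i)).filter p).card := by
  have hinv : ∀ γ, rootRefl (R.root i) (rootRefl (R.root i) γ) = γ := fun γ ↦ by
    rw [← Module.End.mul_apply, rootRefl_mul_self, Module.End.one_apply]
  refine Finset.card_bij' (fun γ _ ↦ rootRefl (R.root i) γ) (fun γ _ ↦ rootRefl (R.root i) γ)
    ?_ ?_ (fun γ _ ↦ hinv γ) (fun γ _ ↦ hinv γ)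
  · intro γ hγ
    rw [Finset.mem_filter, Finset.mem_erase] at hγ
    exact Finset.mem_filter.2 ⟨R.rootRefl_mem_of_mem i hγ.1.2 hγ.1.1, hγ.2⟩
  · intro γ hγ
    rw [Finset.mem_filter, Finset.mem_erase] at hγ
    exact Finset.mem_filter.2 ⟨R.rootRefl_mem_of_mem i hγ.1.2 hγ.1.1, by rw [hinv]; exact hγ.2⟩

theorem card_filter_eq_erase (i : B) (p : V → Prop) [DecidablePred p] :
    (R.pos.filter p).card
      = ((R.pos.erase (R.root i)).filter p).card + if p (R.root i) then 1 else 0 := by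
  conv_lhs => rw [← Finset.insert_erase (R.root_mem i)]
  rw [Finset.filter_insert]
  split_ifs with h
  · rw [Finset.card_insert_of_notMem (by simp)]
  · rfl

/-- The length of `w` is the number of positive roots made negative by `w`. -/
theorem length_eq_card (w : W) :
    cs.length w = (R.pos.filter fun γ ↦ R.rep cs w γ ∉ R.pos).card := by
  induction hk : cs.length w generalizing w with
  | zero =>
    obtain rfl := cs.length_eq_zero_iff.1 hk
    symm
    rw [Finset.card_eq_zero, Finset.filter_eq_empty_iff]
    intro γ hγ
    simpa using hγ
  | succ k ih =>
    have hw : w ≠ 1 := by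
      rintro rfl
      simp at hk
    obtain ⟨i, hi⟩ := cs.exists_rightDescent_of_ne_one hw
    rw [cs.isRightDescent_iff] at hi
    obtain ⟨u, rfl⟩ : ∃ u, w = u * cs.simple i := ⟨w * cs.simple i, by simp⟩
    rw [cs.simple_mul_simple_cancel_right] at hi
    have hu := (R.rep_root_mem_iff cs u i).2 (by omega)
    rw [ih u (by omega), R.card_filter_eq_erase i, R.card_filter_eq_erase i, rep_mul_simple_root,
      if_neg (not_not.2 hu), if_pos (R.neg_notMem hu),
      ← R.card_filter_rootRefl i fun γ ↦ R.rep cs u γ ∉ R.pos]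
    simp only [map_mul, rep_simple, Module.End.mul_apply]

/-- The Weyl group acts transitively on the chambers. -/
theorem exists_rep_inner_pos (y : V) (hy : ∀ γ ∈ R.pos, ⟪y, γ⟫_ℝ ≠ 0) :
    ∃ w : W, ∀ γ ∈ R.pos, 0 < ⟪R.rep cs w y, γ⟫_ℝ := by
  have key : ∀ (k : ℕ) (y : V), (∀ γ ∈ R.pos, ⟪y, γ⟫_ℝ ≠ 0) →
      (R.pos.filter fun γ ↦ ⟪y, γ⟫_ℝ < 0).card = k →
      ∃ w : W, ∀ γ ∈ R.pos, 0 < ⟪R.rep cs w y, γ⟫_ℝ := by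
    intro k
    induction k with
    | zero =>
      intro y hy h
      rw [Finset.card_eq_zero, Finset.filter_eq_empty_iff] at h
      refine ⟨1, fun γ hγ ↦ ?_⟩
      rw [map_one, Module.End.one_apply]
      exact lt_of_le_of_ne (not_lt.1 (h hγ)) (hy γ hγ).symm
    | succ k ih =>
      intro y hy h
      obtain ⟨i, hi⟩ : ∃ i, ⟪y, R.root i⟫_ℝ < 0 := by
        by_contra! hcon
        have hpos := R.inner_pos y fun i ↦
          lt_of_le_of_ne (hcon i) (hy _ (R.root_mem i)).symm
        rw [Finset.filter_eq_empty_iff.2 fun γ hγ ↦ not_lt.2 (hpos γ hγ).le] at h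
        simp at h
      have hinner : ∀ γ, ⟪rootRefl (R.root i) y, γ⟫_ℝ = ⟪y, rootRefl (R.root i) γ⟫_ℝ := fun γ ↦ by
        rw [← inner_rootRefl_rootRefl (R.root i) y, ← Module.End.mul_apply, rootRefl_mul_self,
          Module.End.one_apply]
      have hne : ∀ γ ∈ R.pos, ⟪rootRefl (R.root i) y, γ⟫_ℝ ≠ 0 := by
        intro γ hγ
        rw [hinner]
        by_cases h : γ = R.root i
        · rw [h, rootRefl_self, inner_neg_right]
          linarith
        · exact hy _ (R.rootRefl_mem i γ hγ h)
      have hcard : (R.pos.filter fun γ ↦ ⟪rootRefl (R.root i) y, γ⟫_ℝ < 0).card = k := by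
        rw [R.card_filter_eq_erase i, if_pos hi,
          ← R.card_filter_rootRefl i fun γ ↦ ⟪y, γ⟫_ℝ < 0] at h
        rw [R.card_filter_eq_erase i, hinner, rootRefl_self, inner_neg_right, if_neg (by linarith)]
        simp only [hinner]
        omega
      obtain ⟨w, hw⟩ := ih _ hne hcard
      refine ⟨w * cs.simple i, fun γ hγ ↦ ?_⟩
      rw [map_mul, rep_simple, Module.End.mul_apply]
      exact hw γ hγ
  exact key _ y hy rfl

/-- If the word `ω` makes `γ` negative then some letter of `ω` has root `γ` after applying the
letters on its right, and deleting it multiplies by the reflection in `γ`. -/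
theorem exists_deletion (ω : List B) {γ : V} (hγ : γ ∈ R.pos)
    (h : R.rep cs (cs.wordProd ω) γ ∉ R.pos) :
    ∃ (ω₁ ω₂ : List B) (i : B), ω = ω₁ ++ i :: ω₂ ∧ R.rep cs (cs.wordProd ω₂) γ = R.root i := by
  induction ω with
  | nil => simp [hγ] at h
  | cons j ω ih =>
    by_cases h' : R.rep cs (cs.wordProd ω) γ ∈ R.pos
    · refine ⟨[], ω, j, rfl, ?_⟩
      by_contra hne
      rw [cs.wordProd_cons, map_mul, rep_simple, Module.End.mul_apply] at h
      exact h (R.rootRefl_mem j _ h' hne)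
    · obtain ⟨ω₁, ω₂, i, rfl, hi⟩ := ih h'
      exact ⟨j :: ω₁, ω₂, i, rfl, hi⟩

theorem exists_isReflection {γ : V} (hγ : γ ∈ R.pos) :
    ∃ t, cs.IsReflection t ∧ R.rep cs t = rootRefl γ := by
  obtain ⟨w, hw⟩ := R.exists_rep_inner_pos cs (-R.rho) fun γ hγ ↦ by
    rw [inner_neg_left]
    exact (neg_neg_of_pos (R.rho_pos γ hγ)).ne
  have hneg : R.rep cs w⁻¹ γ ∉ R.pos := by
    intro h
    have h1 := R.rho_pos _ h
    have h2 := hw γ hγ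
    rw [map_neg, inner_neg_left, inner_rep_left] at h2
    linarith
  obtain ⟨ω, hω⟩ := cs.wordProd_surjective w⁻¹
  rw [← hω] at hneg
  obtain ⟨-, ω₂, i, -, hi⟩ := R.exists_deletion cs ω hγ hneg
  refine ⟨(cs.wordProd ω₂)⁻¹ * cs.simple i * ((cs.wordProd ω₂)⁻¹)⁻¹, ⟨_, _, rfl⟩, ?_⟩
  rw [R.rep_conj cs (R.rep_simple cs i), ← hi, rep_inv_rep]

/-- The reflection in the positive root `γ`, as an element of `W`. -/
noncomputable def refl (γ : V) : W :=
  if h : γ ∈ R.pos then (R.exists_isReflection cs h).choose else 1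

theorem isReflection_refl {γ : V} (h : γ ∈ R.pos) : cs.IsReflection (R.refl cs γ) := by
  rw [refl, dif_pos h]
  exact (R.exists_isReflection cs h).choose_spec.1

theorem rep_refl {γ : V} (h : γ ∈ R.pos) : R.rep cs (R.refl cs γ) = rootRefl γ := by
  rw [refl, dif_pos h]
  exact (R.exists_isReflection cs h).choose_spec.2

theorem length_mul_refl_lt {w : W} {γ : V} (hγ : γ ∈ R.pos) (h : R.rep cs w γ ∉ R.pos) :
    cs.length (w * R.refl cs γ) < cs.length w := by
  obtain ⟨ω, hω, rfl⟩ := cs.exists_isReduced w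
  obtain ⟨ω₁, ω₂, i, rfl, hi⟩ := R.exists_deletion cs ω hγ h
  have hconj : cs.wordProd ω₂ * R.refl cs γ * (cs.wordProd ω₂)⁻¹ = cs.simple i := by
    apply R.eq_of_rep_eq cs
    rw [R.rep_conj cs (R.rep_refl cs hγ), hi, rep_simple]
  have : cs.wordProd (ω₁ ++ i :: ω₂) * R.refl cs γ = cs.wordProd (ω₁ ++ ω₂) := by
    rw [cs.wordProd_append, cs.wordProd_cons, cs.wordProd_append, mul_assoc, mul_assoc,
      mul_inv_eq_iff_eq_mul.1 hconj, cs.simple_mul_simple_cancel_left]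
  rw [this, hω.eq]
  refine (cs.length_wordProd_le _).trans_lt ?_
  simp

theorem length_lt_mul_refl {w : W} {γ : V} (hγ : γ ∈ R.pos) (h : R.rep cs w γ ∈ R.pos) :
    cs.length w < cs.length (w * R.refl cs γ) := by
  have h1 : R.rep cs (w * R.refl cs γ) γ ∉ R.pos := by
    rw [map_mul, rep_refl _ _ hγ, Module.End.mul_apply, rootRefl_self, map_neg]
    exact R.neg_notMem h
  have h2 := R.length_mul_refl_lt cs hγ h1
  rwa [mul_assoc, (R.isReflection_refl cs hγ).mul_self, mul_one] at h2

theorem bruhatLE_mul_prod_refl {L : List V} (hL : L.Pairwise (⟪·, ·⟫_ℝ = 0))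
    (hpos : ∀ γ ∈ L, γ ∈ R.pos) (x : W) (hx : ∀ γ ∈ L, R.rep cs x γ ∈ R.pos) :
    cs.bruhatLE x (x * (L.map (R.refl cs)).prod) := by
  induction L generalizing x with
  | nil =>
    rw [List.map_nil, List.prod_nil, mul_one]
    exact Relation.ReflTransGen.refl
  | cons γ L ih =>
    rw [List.pairwise_cons] at hL
    simp only [List.mem_cons, forall_eq_or_imp] at hpos hx
    rw [List.map_cons, List.prod_cons, ← mul_assoc]
    refine Relation.ReflTransGen.head
      ⟨⟨_, R.isReflection_refl cs hpos.1, rfl⟩, R.length_lt_mul_refl cs hpos.1 hx.1⟩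
      (ih hL.2 hpos.2 _ fun η hη ↦ ?_)
    rw [map_mul, rep_refl _ _ hpos.1, Module.End.mul_apply,
      rootRefl_of_inner_eq_zero (hL.1 η hη)]
    exact hx.2 η hη

end PositiveSystem

namespace PositiveSystem

variable {B W V : Type*} [Group W] {M : CoxeterMatrix B} (cs : CoxeterSystem M W)
  [NormedAddCommGroup V] [InnerProductSpace ℝ V] (R : PositiveSystem M V)

theorem rep_eq_self_of_mem_parabolic {J : Set B} {h : V} (hJ : ∀ i ∈ J, ⟪h, R.root i⟫_ℝ = 0)
    {u : W} (hu : u ∈ cs.parabolic J) : R.rep cs u h = h := by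
  induction hu using Subgroup.closure_induction with
  | mem x hx =>
    obtain ⟨i, hi, rfl⟩ := hx
    rw [rep_simple, rootRefl_of_inner_eq_zero]
    rw [real_inner_comm, hJ i hi]
  | one => simp
  | mul x y _ _ hx hy => rw [map_mul, Module.End.mul_apply, hy, hx]
  | inv x _ hx =>
    conv_lhs => rw [← hx]
    rw [rep_inv_rep]

theorem inner_rep_right_of_rep_eq {h : V} {u : W} (hu : R.rep cs u h = h) (γ : V) :
    ⟪h, R.rep cs u γ⟫_ℝ = ⟪h, γ⟫_ℝ := by
  conv_lhs => rw [← hu]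
  rw [inner_rep_rep]

theorem rep_mem_of_inner_pos {h : V} (hpos : ∀ γ ∈ R.pos, 0 ≤ ⟪h, γ⟫_ℝ) {u : W}
    (hu : R.rep cs u h = h) {γ : V} (hγ : γ ∈ R.pos) (hγh : ⟪h, γ⟫_ℝ ≠ 0) :
    R.rep cs u γ ∈ R.pos := by
  refine (R.rep_mem cs u hγ).resolve_right fun h' ↦ hγh ?_
  have h1 := hpos _ h'
  rw [inner_neg_right, R.inner_rep_right_of_rep_eq cs hu] at h1
  exact le_antisymm (by linarith) (hpos γ hγ)

theorem isMinRep_of_forall {J : Set B} {h : V} (hpos : ∀ γ ∈ R.pos, 0 ≤ ⟪h, γ⟫_ℝ)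
    (hJ : ∀ i ∈ J, ⟪h, R.root i⟫_ℝ = 0) {x : W}
    (hx : ∀ γ ∈ R.pos, ⟪h, γ⟫_ℝ = 0 → R.rep cs x⁻¹ γ ∈ R.pos) : cs.IsMinRep J x := by
  intro u hu
  replace hu := R.rep_eq_self_of_mem_parabolic cs hJ hu
  rw [← cs.length_inv x, ← cs.length_inv (u * x), R.length_eq_card, R.length_eq_card]
  refine Finset.card_le_card_of_injOn (R.rep cs u) (fun γ hγ ↦ ?_) (R.rep_injective cs u).injOn
  simp only [Finset.coe_filter, Set.mem_ofPred_eq] at hγ ⊢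
  refine ⟨R.rep_mem_of_inner_pos cs hpos hu hγ.1 fun h0 ↦ hγ.2 (hx γ hγ.1 h0), ?_⟩
  rw [mul_inv_rev, map_mul, Module.End.mul_apply, rep_inv_rep]
  exact hγ.2

/-- The stabilizer of a dominant vector is a standard parabolic subgroup. -/
theorem mem_parabolic_of_rep_eq_self {J : Set B} {h : V} (hpos : ∀ γ ∈ R.pos, 0 ≤ ⟪h, γ⟫_ℝ)
    (hJ : ∀ i, i ∈ J ↔ ⟪h, R.root i⟫_ℝ = 0) {w : W} (hw : R.rep cs w h = h) :
    w ∈ cs.parabolic J := by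
  induction hk : cs.length w generalizing w with
  | zero =>
    rw [cs.length_eq_zero_iff.1 hk]
    exact one_mem _
  | succ k ih =>
    have hw1 : w ≠ 1 := by
      rintro rfl
      simp at hk
    obtain ⟨i, hi⟩ := cs.exists_rightDescent_of_ne_one hw1
    have hroot : R.rep cs w (R.root i) ∉ R.pos := fun h' ↦
      lt_asymm hi ((R.rep_root_mem_iff cs w i).1 h')
    have hh : ⟪h, R.root i⟫_ℝ = 0 := by
      by_contra hne
      exact hroot (R.rep_mem_of_inner_pos cs hpos hw (R.root_mem i) hne)
    have hs : cs.simple i ∈ cs.parabolic J :=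
      Subgroup.subset_closure ⟨i, (hJ i).2 hh, rfl⟩
    rw [cs.isRightDescent_iff] at hi
    rw [← cs.simple_mul_simple_cancel_right i (w := w)]
    refine mul_mem (ih ?_ (by omega)) hs
    rw [map_mul, Module.End.mul_apply,
      R.rep_eq_self_of_mem_parabolic cs (fun i hi ↦ (hJ i).1 hi) hs, hw]

theorem rep_prod_refl {L : List V} (hL : ∀ γ ∈ L, γ ∈ R.pos) :
    R.rep cs (L.map (R.refl cs)).prod = (L.map rootRefl).prod := by
  rw [map_list_prod, List.map_map]
  exact congrArg List.prod (List.map_congr_left fun γ hγ ↦ R.rep_refl cs (hL γ hγ))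

theorem exists_rep_eq_prod_rootRefl {l : List W} (hl : ∀ t ∈ l, cs.IsReflection t) :
    ∃ L : List V, L.length = l.length ∧ R.rep cs l.prod = (L.map rootRefl).prod := by
  induction l with
  | nil => exact ⟨[], rfl, by simp⟩
  | cons t l ih =>
    simp only [List.mem_cons, forall_eq_or_imp] at hl
    obtain ⟨L, hlen, hL⟩ := ih hl.2
    obtain ⟨w, i, rfl⟩ := hl.1
    refine ⟨R.rep cs w (R.root i) :: L, by simp [hlen], ?_⟩
    rw [List.prod_cons, map_mul, hL, R.rep_conj cs (R.rep_simple cs i), List.map_cons,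
      List.prod_cons]

theorem reflLen_prod_refl {L : List V} (hL : L.Pairwise (⟪·, ·⟫_ℝ = 0))
    (hLpos : ∀ γ ∈ L, γ ∈ R.pos) : cs.reflLen (L.map (R.refl cs)).prod = L.length := by
  have hmem : L.length ∈ {n | ∃ l : List W, l.length = n ∧ (∀ t ∈ l, cs.IsReflection t) ∧
      l.prod = (L.map (R.refl cs)).prod} :=
    ⟨L.map (R.refl cs), by simp, by
      simpa using fun γ hγ ↦ R.isReflection_refl cs (hLpos γ hγ), rfl⟩
  refine le_antisymm (Nat.sInf_le hmem) (le_csInf ⟨_, hmem⟩ ?_)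
  rintro n ⟨l, rfl, hl, hprod⟩
  obtain ⟨L', hlen, hL'⟩ := R.exists_rep_eq_prod_rootRefl cs hl
  rw [← hlen]
  refine length_le_of_prod_rootRefl_eq hL (fun γ hγ ↦ R.ne_zero (hLpos γ hγ)) ?_
  rw [← hL', hprod, R.rep_prod_refl cs hLpos]

/-- If pairwise orthogonal roots in a standard parabolic subsystem span a vector in its open
fundamental chamber, then the product of their reflections is the longest element. -/
theorem isLongestOf_eq_prod_refl {J : Set B} {h : V} (hpos : ∀ γ ∈ R.pos, 0 ≤ ⟪h, γ⟫_ℝ)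
    (hJ : ∀ i, i ∈ J ↔ ⟪h, R.root i⟫_ℝ = 0) {L : List V} (hL : L.Pairwise (⟪·, ·⟫_ℝ = 0))
    (hLpos : ∀ γ ∈ L, γ ∈ R.pos) (hLh : ∀ γ ∈ L, ⟪h, γ⟫_ℝ = 0) {v : V}
    (hv : v ∈ Submodule.span ℝ {γ | γ ∈ L})
    (hvpos : ∀ η ∈ R.pos, ⟪h, η⟫_ℝ = 0 → 0 < ⟪v, η⟫_ℝ) {w : W} (hw : cs.IsLongestOf J w) :
    w = (L.map (R.refl cs)).prod ∧
      cs.length w = (R.pos.filter fun γ ↦ ⟪h, γ⟫_ℝ = 0).card ∧ cs.reflLen w = L.length := by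
  set θ := (L.map (R.refl cs)).prod with hθ
  have hθh : R.rep cs θ h = h := by
    rw [hθ, R.rep_prod_refl cs hLpos]
    clear_value θ
    clear hθ hL hv hLpos
    induction L with
    | nil => simp
    | cons γ L ih =>
      simp only [List.mem_cons, forall_eq_or_imp] at hLh
      rw [List.map_cons, List.prod_cons, Module.End.mul_apply, ih hLh.2,
        rootRefl_of_inner_eq_zero]
      rw [real_inner_comm, hLh.1]
  have hθv : R.rep cs θ v = -v := by
    rw [hθ, R.rep_prod_refl cs hLpos, prod_rootRefl_apply_of_mem_span hL hv]
  have hθh' : R.rep cs θ⁻¹ h = h := by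
    conv_lhs => rw [← hθh]
    rw [rep_inv_rep]
  have hθv' : R.rep cs θ⁻¹ v = -v := by
    have := R.rep_inv_rep cs θ v
    rw [hθv, map_neg] at this
    exact neg_eq_iff_eq_neg.1 this
  have hneg : ∀ g : W, R.rep cs g h = h → R.rep cs g v = -v → ∀ γ ∈ R.pos, ⟪h, γ⟫_ℝ = 0 →
      R.rep cs g γ ∉ R.pos := by
    intro g hgh hgv γ hγ h0 hmem
    have h1 := hvpos _ hmem (by rw [R.inner_rep_right_of_rep_eq cs hgh, h0])
    have h2 := hvpos γ hγ h0
    rw [← R.inner_rep_rep cs g, hgv, inner_neg_left] at h2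
    linarith
  have hsub : ∀ g : W, R.rep cs g h = h → (R.pos.filter fun γ ↦ R.rep cs g γ ∉ R.pos) ⊆
      R.pos.filter fun γ ↦ ⟪h, γ⟫_ℝ = 0 := by
    intro g hg γ hγ
    rw [Finset.mem_filter] at hγ ⊢
    refine ⟨hγ.1, ?_⟩
    by_contra hne
    exact hγ.2 (R.rep_mem_of_inner_pos cs hpos hg hγ.1 hne)
  have hNθ : (R.pos.filter fun γ ↦ R.rep cs θ γ ∉ R.pos) =
      R.pos.filter fun γ ↦ ⟪h, γ⟫_ℝ = 0 := by
    refine (hsub θ hθh).antisymm fun γ hγ ↦ ?_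
    rw [Finset.mem_filter] at hγ ⊢
    exact ⟨hγ.1, hneg θ hθh hθv γ hγ.1 hγ.2⟩
  have hwh : R.rep cs w h = h :=
    R.rep_eq_self_of_mem_parabolic cs (fun i hi ↦ (hJ i).1 hi) hw.1
  have hNw : (R.pos.filter fun γ ↦ R.rep cs w γ ∉ R.pos) =
      R.pos.filter fun γ ↦ ⟪h, γ⟫_ℝ = 0 := by
    refine Finset.eq_of_subset_of_card_le (hsub w hwh) ?_
    rw [← hNθ, ← R.length_eq_card, ← R.length_eq_card]
    exact hw.2 θ (R.mem_parabolic_of_rep_eq_self cs hpos hJ hθh)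
  have hwθ : w = θ := by
    rw [← mul_inv_eq_one]
    refine R.eq_one_of_forall_rep_root_mem cs fun i ↦ ?_
    rw [map_mul, Module.End.mul_apply]
    have hi := R.root_mem i
    have hih := R.inner_rep_right_of_rep_eq cs hθh' (R.root i)
    by_cases h0 : ⟪h, R.root i⟫_ℝ = 0
    · have h1 := (R.rep_mem cs θ⁻¹ hi).resolve_left (hneg _ hθh' hθv' _ hi h0)
      have h2 : -R.rep cs θ⁻¹ (R.root i) ∈ R.pos.filter fun γ ↦ R.rep cs w γ ∉ R.pos := by
        rw [hNw, Finset.mem_filter, inner_neg_right, hih, h0, neg_zero]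
        exact ⟨h1, rfl⟩
      have h3 := (R.rep_mem cs w h1).resolve_left (Finset.mem_filter.1 h2).2
      rwa [map_neg, neg_neg] at h3
    · exact R.rep_mem_of_inner_pos cs hpos hwh (R.rep_mem_of_inner_pos cs hpos hθh' hi h0)
        (by rwa [hih])
  refine ⟨hwθ, ?_, ?_⟩
  · rw [R.length_eq_card, hNw]
  · rw [hwθ, hθ, R.reflLen_prod_refl cs hL hLpos]

end PositiveSystem

section Cascade

variable {V : Type*} [NormedAddCommGroup V] [InnerProductSpace ℝ V]

/-- `Cascade h Q L` says that `L` is obtained from `Q` by repeatedly choosing a root and passing to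
the roots orthogonal to it, the choice being compatible with the roots orthogonal to `h`. -/
inductive Cascade (h : V) : Finset V → List V → Prop
  | nil : Cascade h ∅ []
  | cons {Q : Finset V} {γ : V} {L : List V} (mem : γ ∈ Q)
      (inner_nonneg : ∀ η ∈ Q, ⟪h, η⟫_ℝ = 0 → 0 ≤ ⟪γ, η⟫_ℝ)
      (inner_eq_zero : ⟪h, γ⟫_ℝ ≠ 0 → ∀ η ∈ Q, ⟪h, η⟫_ℝ = 0 → ⟪γ, η⟫_ℝ = 0)
      (sum_sign : ∑ η ∈ Q, (SignType.sign ⟪γ, η⟫_ℝ : ℤ) =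
        (Q.filter fun η ↦ ⟪h, η⟫_ℝ = 0 ∧ ⟪γ, η⟫_ℝ ≠ 0).card + if ⟪h, γ⟫_ℝ = 0 then 0 else 1)
      (tail : Cascade h (Q.filter fun η ↦ ⟪γ, η⟫_ℝ = 0) L) : Cascade h Q (γ :: L)

namespace Cascade

variable {h : V} {Q : Finset V} {L : List V}

theorem subset (hL : Cascade h Q L) : ∀ γ ∈ L, γ ∈ Q := by
  induction hL with
  | nil => simp
  | cons mem _ _ _ _ ih =>
    simp only [List.mem_cons, forall_eq_or_imp]
    exact ⟨mem, fun γ hγ ↦ (Finset.mem_filter.1 (ih γ hγ)).1⟩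

theorem pairwise (hL : Cascade h Q L) : L.Pairwise (⟪·, ·⟫_ℝ = 0) := by
  induction hL with
  | nil => simp
  | cons _ _ _ _ tail ih =>
    exact List.pairwise_cons.2 ⟨fun γ hγ ↦ (Finset.mem_filter.1 (tail.subset γ hγ)).2, ih⟩

theorem sign_mul_add {C a b : ℝ} (h : |b| < C * |a|) (ha : a ≠ 0) :
    SignType.sign (C * a + b) = SignType.sign a := by
  rw [abs_lt] at h
  rcases ha.lt_or_gt with ha | ha
  · rw [abs_of_neg ha] at h
    rw [sign_neg ha, sign_neg (by linarith)]
  · rw [abs_of_pos ha] at h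
    rw [sign_pos ha, sign_pos (by linarith)]

theorem exists_regular (hL : Cascade h Q L) (h0 : (0 : V) ∉ Q) :
    ∃ y ∈ Submodule.span ℝ {γ | γ ∈ L},
    ∃ v ∈ Submodule.span ℝ {γ | γ ∈ L.filter fun γ ↦ ⟪h, γ⟫_ℝ = 0},
      (∀ γ ∈ L, 0 < ⟪y, γ⟫_ℝ) ∧ (∀ η ∈ Q, ⟪y, η⟫_ℝ ≠ 0) ∧
      (∀ η ∈ Q, ⟪h, η⟫_ℝ = 0 → 0 < ⟪y, η⟫_ℝ ∧ 0 < ⟪v, η⟫_ℝ) ∧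
      ∑ η ∈ Q, (SignType.sign ⟪y, η⟫_ℝ : ℤ) = (Q.filter fun η ↦ ⟪h, η⟫_ℝ = 0).card +
        (L.length - (L.filter fun γ ↦ ⟪h, γ⟫_ℝ = 0).length) := by
  induction hL with
  | nil => exact ⟨0, zero_mem _, 0, zero_mem _, by simp⟩
  | @cons Q γ L mem inner_nonneg inner_eq_zero sum_sign tail ih =>
    obtain ⟨y, hy, v, hv, hyL, hyQ, hpos, hsum⟩ := ih fun h ↦ h0 (Finset.mem_filter.1 h).1
    have hγ : γ ≠ 0 := fun h ↦ h0 (h ▸ mem)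
    have hγγ : 0 < ⟪γ, γ⟫_ℝ := real_inner_self_pos.2 hγ
    have htend : ∀ u η : V, ⟪γ, η⟫_ℝ ≠ 0 →
        ∀ᶠ C : ℝ in Filter.atTop, |⟪u, η⟫_ℝ| < C * |⟪γ, η⟫_ℝ| := fun u η hη ↦
      (Filter.tendsto_id.atTop_mul_const (abs_pos.2 hη)).eventually_gt_atTop _
    obtain ⟨C, hC⟩ : ∃ C : ℝ, ∀ η ∈ Q, ⟪γ, η⟫_ℝ ≠ 0 →
        |⟪y, η⟫_ℝ| < C * |⟪γ, η⟫_ℝ| ∧ |⟪v, η⟫_ℝ| < C * |⟪γ, η⟫_ℝ| := by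
      refine Filter.Eventually.exists (f := Filter.atTop) ((Finset.eventually_all Q).2 fun η _ ↦ ?_)
      by_cases hη : ⟪γ, η⟫_ℝ = 0
      · simp [hη]
      · filter_upwards [htend y η hη, htend v η hη] with C h1 h2 _ using ⟨h1, h2⟩
    have hinner : ∀ u η, ⟪C • γ + u, η⟫_ℝ = C * ⟪γ, η⟫_ℝ + ⟪u, η⟫_ℝ := fun u η ↦ by
      rw [inner_add_left, real_inner_smul_left]
    have hsign : ∀ η ∈ Q, ⟪γ, η⟫_ℝ ≠ 0 →
        SignType.sign ⟪C • γ + y, η⟫_ℝ = SignType.sign ⟪γ, η⟫_ℝ := fun η hη h' ↦ by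
      rw [hinner, sign_mul_add (hC η hη h').1 h']
    have hsign' : ∀ η ∈ Q, ⟪γ, η⟫_ℝ ≠ 0 →
        SignType.sign ⟪C • γ + v, η⟫_ℝ = SignType.sign ⟪γ, η⟫_ℝ := fun η hη h' ↦ by
      rw [hinner, sign_mul_add (hC η hη h').2 h']
    have hspan : Submodule.span ℝ {δ | δ ∈ L} ≤ Submodule.span ℝ {δ | δ ∈ γ :: L} :=
      Submodule.span_mono fun δ hδ ↦ List.mem_cons_of_mem _ hδ
    refine ⟨C • γ + y, add_mem (Submodule.smul_mem _ _ (Submodule.subset_span (by simp)))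
      (hspan hy), if ⟪h, γ⟫_ℝ = 0 then C • γ + v else v, ?_, ?_, ?_, ?_, ?_⟩
    · split_ifs with hh
      · rw [List.filter_cons_of_pos (by simpa using hh)]
        exact add_mem (Submodule.smul_mem _ _ (Submodule.subset_span (by simp)))
          (Submodule.span_mono (fun δ hδ ↦ List.mem_cons_of_mem _ hδ) hv)
      · rwa [List.filter_cons_of_neg (by simpa using hh)]
    · simp only [List.mem_cons, forall_eq_or_imp]
      refine ⟨?_, fun δ hδ ↦ ?_⟩
      · rw [← sign_eq_one_iff, hsign γ mem hγγ.ne', sign_eq_one_iff]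
        exact hγγ
      · rw [hinner, (Finset.mem_filter.1 (tail.subset δ hδ)).2, mul_zero, zero_add]
        exact hyL δ hδ
    · intro η hη
      by_cases h' : ⟪γ, η⟫_ℝ = 0
      · rw [hinner, h', mul_zero, zero_add]
        exact hyQ η (Finset.mem_filter.2 ⟨hη, h'⟩)
      · rwa [← sign_ne_zero, hsign η hη h', sign_ne_zero]
    · intro η hη hh
      by_cases h' : ⟪γ, η⟫_ℝ = 0
      · have := hpos η (Finset.mem_filter.2 ⟨hη, h'⟩) hh
        split_ifs
        · rwa [hinner, hinner, h', mul_zero, zero_add, zero_add]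
        · rwa [hinner, h', mul_zero, zero_add]
      · have hlt := lt_of_le_of_ne (inner_nonneg η hη hh) (Ne.symm h')
        rw [if_pos (not_not.1 fun hγh ↦ h' (inner_eq_zero hγh η hη hh)), ← sign_eq_one_iff,
          ← sign_eq_one_iff, hsign η hη h', hsign' η hη h', sign_eq_one_iff]
        exact ⟨hlt, hlt⟩
    · have hsplit : ∑ η ∈ Q, (SignType.sign ⟪C • γ + y, η⟫_ℝ : ℤ) =
          ∑ η ∈ Q, (SignType.sign ⟪γ, η⟫_ℝ : ℤ) +
            ∑ η ∈ Q.filter fun η ↦ ⟪γ, η⟫_ℝ = 0, (SignType.sign ⟪y, η⟫_ℝ : ℤ) := by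
        rw [Finset.sum_filter, ← Finset.sum_add_distrib]
        refine Finset.sum_congr rfl fun η hη ↦ ?_
        split_ifs with h'
        · simp [hinner, h']
        · rw [hsign η hη h', add_zero]
      have hcard := Finset.card_filter_add_card_filter_not (s := Q.filter fun η ↦ ⟪h, η⟫_ℝ = 0)
        fun η ↦ ⟪γ, η⟫_ℝ = 0
      rw [Finset.filter_filter, Finset.filter_filter] at hcard
      rw [Finset.filter_filter, Finset.filter_congr fun η _ ↦ and_comm] at hsum
      rw [hsplit, sum_sign, hsum, ← hcard, List.filter_cons]
      by_cases hh : ⟪h, γ⟫_ℝ = 0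
      · simp only [hh, if_true, decide_true, List.length_cons]
        push_cast
        ring
      · simp only [hh, if_false, decide_false, List.length_cons, Bool.false_eq_true]
        push_cast
        ring

end Cascade

end Cascade

namespace PositiveSystem

variable {B W V : Type*} [Group W] {M : CoxeterMatrix B} (cs : CoxeterSystem M W)
  [NormedAddCommGroup V] [InnerProductSpace ℝ V] (R : PositiveSystem M V)

theorem exists_isMinRep_bruhatLE {J : Set B} {h : V} (hpos : ∀ γ ∈ R.pos, 0 ≤ ⟪h, γ⟫_ℝ)
    (hJ : ∀ i, i ∈ J ↔ ⟪h, R.root i⟫_ℝ = 0) {L : List V} (hL : Cascade h R.pos L)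
    {w0 : W} (hw0 : cs.IsLongestOf Set.univ w0) {wJ : W} (hwJ : cs.IsLongestOf J wJ) :
    ∃ x : W, cs.IsMinRep J x ∧ cs.bruhatLE x (x * w0) ∧
      (2 * cs.length x : ℤ)
        = ((cs.length w0 : ℤ) - (cs.reflLen w0 : ℤ))
          - ((cs.length wJ : ℤ) - (cs.reflLen wJ : ℤ)) := by
  obtain ⟨y, hy, v, hv, hyL, hyne, hyv, hsum⟩ := hL.exists_regular fun h ↦ R.ne_zero h rfl
  obtain ⟨w, hw⟩ := R.exists_rep_inner_pos cs y hyne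
  have hmem : ∀ γ ∈ R.pos, R.rep cs w γ ∈ R.pos ↔ 0 < ⟪y, γ⟫_ℝ := by
    intro γ hγ
    rw [← R.inner_rep_rep cs w]
    refine ⟨hw _, fun h ↦ (R.rep_mem cs w hγ).resolve_right fun h' ↦ ?_⟩
    have := hw _ h'
    rw [inner_neg_right] at this
    linarith
  have hLpos : ∀ γ ∈ L, R.rep cs w γ ∈ R.pos := fun γ hγ ↦
    (hmem γ (hL.subset γ hγ)).2 (hyL γ hγ)
  have hmap : (L.map (R.rep cs w)).Pairwise (⟪·, ·⟫_ℝ = 0) := by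
    rw [List.pairwise_map]
    simpa only [inner_rep_rep] using hL.pairwise
  have hmappos : ∀ γ ∈ L.map (R.rep cs w), γ ∈ R.pos := by simpa using hLpos
  have hspan : R.rep cs w y ∈ Submodule.span ℝ {γ | γ ∈ L.map (R.rep cs w)} := by
    have := Submodule.mem_map_of_mem (f := R.rep cs w) hy
    rw [Submodule.map_span] at this
    refine Submodule.span_mono ?_ this
    rintro _ ⟨γ, hγ, rfl⟩
    exact List.mem_map_of_mem hγ
  obtain ⟨hw0', hlen0, hrefl0⟩ := R.isLongestOf_eq_prod_refl cs (h := 0) (by simp) (by simp) hmap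
    hmappos (by simp) hspan (fun η hη _ ↦ hw η hη) hw0
  obtain ⟨-, hlenJ, hreflJ⟩ := R.isLongestOf_eq_prod_refl cs hpos hJ
    (hL.pairwise.filter fun γ ↦ ⟪h, γ⟫_ℝ = 0)
    (fun γ hγ ↦ hL.subset γ (List.mem_of_mem_filter hγ))
    (fun γ hγ ↦ by simpa using List.of_mem_filter hγ) hv (fun η hη hh ↦ (hyv η hη hh).2) hwJ
  refine ⟨w⁻¹, R.isMinRep_of_forall cs hpos (fun i hi ↦ (hJ i).1 hi) fun γ hγ hh ↦ ?_, ?_, ?_⟩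
  · rw [inv_inv, hmem γ hγ]
    exact (hyv γ hγ hh).1
  · rw [hw0']
    refine R.bruhatLE_mul_prod_refl cs hmap hmappos _ ?_
    simp only [List.mem_map, forall_exists_index, and_imp, forall_apply_eq_imp_iff₂, rep_inv_rep]
    exact hL.subset
  · have hsum' : ∑ η ∈ R.pos, (SignType.sign ⟪y, η⟫_ℝ : ℤ) = R.pos.card - 2 * cs.length w := by
      rw [R.length_eq_card, Finset.card_filter, Finset.card_eq_sum_ones]
      push_cast
      rw [Finset.mul_sum, ← Finset.sum_sub_distrib]
      refine Finset.sum_congr rfl fun η hη ↦ ?_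
      simp only [hmem η hη]
      rcases (hyne η hη).lt_or_gt with h' | h'
      · simp [sign_neg h', h'.le]
      · simp [sign_pos h', h']
    rw [cs.length_inv, hlen0, hrefl0, hlenJ, hreflJ]
    simp only [inner_zero_left, Finset.filter_true, List.length_map]
    linarith

end PositiveSystem

section StandardRoots

variable {N : ℕ}

/-- The roots of type `C`, indexed by pairs: `eⱼ - eₗ` if `j < l`, and `eⱼ + eₗ` if `l ≤ j`. -/
noncomputable def pairRoot (p : Fin N × Fin N) : EuclideanSpace ℝ (Fin N) :=
  EuclideanSpace.single p.1 1 + (if p.1 < p.2 then -1 else 1 : ℝ) • EuclideanSpace.single p.2 1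

theorem pairRoot_apply (p : Fin N × Fin N) (m : Fin N) :
    pairRoot p m = (if m = p.1 then 1 else 0) +
      (if m = p.2 then (if p.1 < p.2 then -1 else 1) else 0) := by
  rw [pairRoot, PiLp.add_apply, PiLp.smul_apply, PiLp.single_apply, PiLp.single_apply, smul_eq_mul,
    mul_ite, mul_one, mul_zero]

theorem inner_pairRoot (u : EuclideanSpace ℝ (Fin N)) (p : Fin N × Fin N) :
    ⟪u, pairRoot p⟫_ℝ = if p.1 < p.2 then u p.1 - u p.2 else u p.1 + u p.2 := by
  rw [pairRoot, inner_add_right, inner_smul_right]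
  split_ifs <;> simp [EuclideanSpace.inner_single_right, sub_eq_add_neg]

theorem pairRoot_injective : Function.Injective (pairRoot (N := N)) := by
  intro ⟨j, l⟩ ⟨j', l'⟩ h
  have h' : ∀ m : Fin N,
      ((if m = j then 1 else 0) + (if m = l then (if j < l then -1 else 1) else 0) :
      ℤ) = (if m = j' then 1 else 0) + (if m = l' then (if j' < l' then -1 else 1) else 0) := by
    intro m
    have hm := congrArg (· m) h
    simp only [pairRoot_apply] at hm
    exact_mod_cast hm
  have h1 := h' j
  have h2 := h' l
  have h3 := h' j'
  have h4 := h' l'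
  simp only [Prod.mk.injEq, Fin.ext_iff, Fin.lt_def, if_true] at h1 h2 h3 h4 ⊢
  omega

/-- The contribution of the root indexed by `p` to the counting condition for a cascade starting
with `γ`. -/
noncomputable def excess (h γ : EuclideanSpace ℝ (Fin N)) (p : Fin N × Fin N) : ℤ :=
  SignType.sign ⟪γ, pairRoot p⟫_ℝ -
    if ⟪h, pairRoot p⟫_ℝ = 0 ∧ ⟪γ, pairRoot p⟫_ℝ ≠ 0 then 1 else 0

theorem Cascade.cons_image {h : EuclideanSpace ℝ (Fin N)} {S : Finset (Fin N × Fin N)}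
    {q : Fin N × Fin N} (hq : q ∈ S)
    (hnonneg : ∀ p ∈ S, ⟪h, pairRoot p⟫_ℝ = 0 → 0 ≤ ⟪pairRoot q, pairRoot p⟫_ℝ)
    (hzero : ⟪h, pairRoot q⟫_ℝ ≠ 0 → ∀ p ∈ S, ⟪h, pairRoot p⟫_ℝ = 0 →
      ⟪pairRoot q, pairRoot p⟫_ℝ = 0)
    (hsum : ∑ p ∈ S, excess h (pairRoot q) p = if ⟪h, pairRoot q⟫_ℝ = 0 then 0 else 1)
    {T : Finset (Fin N × Fin N)} (hT : (S.filter fun p ↦ ⟪pairRoot q, pairRoot p⟫_ℝ = 0) = T)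
    {L : List (EuclideanSpace ℝ (Fin N))} (tail : Cascade h (T.image pairRoot) L) :
    Cascade h (S.image pairRoot) (pairRoot q :: L) := by
  refine .cons (Finset.mem_image_of_mem _ hq) ?_ ?_ ?_ ?_
  · simpa only [Finset.forall_mem_image] using hnonneg
  · simpa only [Finset.forall_mem_image] using hzero
  · rw [Finset.sum_image pairRoot_injective.injOn, Finset.filter_image,
      Finset.card_image_of_injective _ pairRoot_injective, Finset.card_filter, ← hsum]
    simp only [excess, Finset.sum_sub_distrib]
    push_cast
    ring
  · rwa [Finset.filter_image, hT]

theorem excess_of_pos {h γ : EuclideanSpace ℝ (Fin N)} {p : Fin N × Fin N}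
    (hp : 0 < ⟪γ, pairRoot p⟫_ℝ) :
    excess h γ p = 1 - if ⟪h, pairRoot p⟫_ℝ = 0 then 1 else 0 := by
  simp [excess, sign_pos hp, hp.ne']

theorem excess_of_neg {h γ : EuclideanSpace ℝ (Fin N)} {p : Fin N × Fin N}
    (hp : ⟪γ, pairRoot p⟫_ℝ < 0) :
    excess h γ p = -1 - if ⟪h, pairRoot p⟫_ℝ = 0 then 1 else 0 := by
  simp [excess, sign_neg hp, hp.ne]

theorem excess_of_eq_zero {h γ : EuclideanSpace ℝ (Fin N)} {p : Fin N × Fin N}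
    (hp : ⟪γ, pairRoot p⟫_ℝ = 0) : excess h γ p = 0 := by
  simp [excess, hp]

theorem sum_product_erase {ι : Type*} [DecidableEq ι] {A : Finset ι} {a : ι} (ha : a ∈ A)
    (G : ι × ι → ℤ) : ∑ p ∈ A ×ˢ A, G p = G (a, a) + ∑ m ∈ A.erase a, (G (a, m) + G (m, a)) +
      ∑ p ∈ A.erase a ×ˢ A.erase a, G p := by
  simp only [Finset.sum_product, ← Finset.add_sum_erase A _ ha, Finset.sum_add_distrib]
  ring

theorem sum_product_eq_of_erase {ι : Type*} [DecidableEq ι] {A : Finset ι} {a : ι} (ha : a ∈ A)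
    {G : ι × ι → ℤ} (h : ∀ m ∈ A.erase a, G (a, m) + G (m, a) = 0)
    (h' : ∀ m ∈ A.erase a, ∀ m' ∈ A.erase a, G (m, m') = 0) : ∑ p ∈ A ×ˢ A, G p = G (a, a) := by
  rw [sum_product_erase ha, Finset.sum_eq_zero h, Finset.sum_eq_zero, add_zero, add_zero]
  intro p hp
  rw [Finset.mem_product] at hp
  exact h' _ hp.1 _ hp.2

theorem sum_product_eq_of_erase_erase {ι : Type*} [DecidableEq ι] {A : Finset ι} {a b : ι}
    (ha : a ∈ A)
    (hb : b ∈ A.erase a) {G : ι × ι → ℤ}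
    (h : ∀ m ∈ (A.erase a).erase b, G (a, m) + G (m, a) + (G (b, m) + G (m, b)) = 0)
    (h' : ∀ m ∈ (A.erase a).erase b, ∀ m' ∈ (A.erase a).erase b, G (m, m') = 0) :
    ∑ p ∈ A ×ˢ A, G p = G (a, a) + (G (a, b) + G (b, a)) + G (b, b) := by
  rw [sum_product_erase ha, sum_product_erase hb, ← Finset.add_sum_erase _ _ hb]
  have h1 := Finset.sum_eq_zero h
  rw [Finset.sum_add_distrib] at h1
  have h2 : ∑ p ∈ (A.erase a).erase b ×ˢ (A.erase a).erase b, G p = 0 :=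
    Finset.sum_eq_zero fun p hp ↦ h' _ (Finset.mem_product.1 hp).1 _ (Finset.mem_product.1 hp).2
  linarith

end StandardRoots

section ExistsCascade

variable {N : ℕ}

theorem inner_pairRoot_of_lt (u : EuclideanSpace ℝ (Fin N)) {j l : Fin N} (hjl : j < l) :
    ⟪u, pairRoot (j, l)⟫_ℝ = u j - u l := by
  rw [inner_pairRoot, if_pos hjl]

theorem inner_pairRoot_of_le (u : EuclideanSpace ℝ (Fin N)) {j l : Fin N} (hlj : l ≤ j) :
    ⟪u, pairRoot (j, l)⟫_ℝ = u j + u l := by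
  rw [inner_pairRoot, if_neg hlj.not_gt]

theorem Cascade.exists_cons_typeA {h : EuclideanSpace ℝ (Fin N)} {A : Finset (Fin N)} {i k : Fin N}
    (hi : i ∈ A) (hk : k ∈ A) (hik : i < k)
    (H : ∀ m ∈ A, m ≠ i → m ≠ k → (i < m ∧ m < k ↔ h m = h i) ∧ (i < m ∧ m < k ↔ h m = h k))
    (htail : ∃ L, Cascade h (((((A.erase i).erase k) ×ˢ ((A.erase i).erase k)).filter
      fun p ↦ p.1 < p.2).image pairRoot) L) :
    ∃ L, Cascade h (((A ×ˢ A).filter fun p ↦ p.1 < p.2).image pairRoot) L := by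
  obtain ⟨L, hL⟩ := htail
  have hgi : pairRoot (i, k) i = 1 := by simp [pairRoot_apply, hik.ne]
  have hgk : pairRoot (i, k) k = -1 := by simp [pairRoot_apply, hik.ne', hik]
  have hg : ∀ m, m ≠ i → m ≠ k → pairRoot (i, k) m = 0 := fun m h1 h2 ↦ by
    simp [pairRoot_apply, h1, h2]
  refine ⟨_, .cons_image (q := (i, k)) (by simp [hi, hk, hik]) ?_ ?_ ?_ ?_ hL⟩
  · rintro ⟨j, l⟩ hp
    simp only [Finset.mem_filter, Finset.mem_product] at hp
    rw [inner_pairRoot_of_lt _ hp.2, inner_pairRoot_of_lt _ hp.2]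
    generalize pairRoot (i, k) = g at *
    beta_reduce at *
    grind
  · rw [inner_pairRoot_of_lt _ hik]
    rintro hne ⟨j, l⟩ hp
    simp only [Finset.mem_filter, Finset.mem_product] at hp
    rw [inner_pairRoot_of_lt _ hp.2, inner_pairRoot_of_lt _ hp.2]
    generalize pairRoot (i, k) = g at *
    beta_reduce at *
    grind
  · rw [Finset.sum_filter, sum_product_eq_of_erase_erase hi (Finset.mem_erase.2 ⟨hik.ne', hk⟩)]
    · have h1 := inner_pairRoot_of_lt (pairRoot (i, k)) hik
      rw [if_neg (lt_irrefl _), if_neg (lt_irrefl _), if_pos hik, if_neg hik.not_gt,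
        excess_of_pos (by rw [h1, hgi, hgk]; norm_num)]
      split_ifs <;> simp
    · intro m hm
      simp only [Finset.mem_erase] at hm
      have hgm := hg m hm.2.1 hm.1
      obtain ⟨h1, h2⟩ := H m hm.2.2 hm.2.1 hm.1
      rcases lt_or_gt_of_ne hm.2.1 with hmi | hmi
      · have hmk := hmi.trans hik
        rw [if_neg hmi.not_gt, if_pos hmi, if_neg hmk.not_gt, if_pos hmk,
          excess_of_neg (by rw [inner_pairRoot_of_lt _ hmi, hgi, hgm]; norm_num),
          excess_of_pos (by rw [inner_pairRoot_of_lt _ hmk, hgk, hgm]; norm_num),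
          inner_pairRoot_of_lt _ hmi, inner_pairRoot_of_lt _ hmk]
        beta_reduce at *
        grind
      rcases lt_or_gt_of_ne hm.1 with hmk | hmk
      · rw [if_pos hmi, if_neg hmi.not_gt, if_neg hmk.not_gt, if_pos hmk,
          excess_of_pos (by rw [inner_pairRoot_of_lt _ hmi, hgi, hgm]; norm_num),
          excess_of_pos (by rw [inner_pairRoot_of_lt _ hmk, hgk, hgm]; norm_num),
          inner_pairRoot_of_lt _ hmi, inner_pairRoot_of_lt _ hmk]
        beta_reduce at *
        grind
      · rw [if_pos hmi, if_neg hmi.not_gt, if_pos hmk, if_neg hmk.not_gt,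
          excess_of_pos (by rw [inner_pairRoot_of_lt _ hmi, hgi, hgm]; norm_num),
          excess_of_neg (by rw [inner_pairRoot_of_lt _ hmk, hgk, hgm]; norm_num),
          inner_pairRoot_of_lt _ hmi, inner_pairRoot_of_lt _ hmk]
        beta_reduce at *
        grind
    · intro m hm m' hm'
      simp only [Finset.mem_erase] at hm hm'
      rw [excess_of_eq_zero, ite_self]
      simp [inner_pairRoot, hg m hm.2.1 hm.1, hg m' hm'.2.1 hm'.1]
  · ext ⟨j, l⟩
    simp only [Finset.mem_filter, Finset.mem_product, Finset.mem_erase]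
    rw [inner_pairRoot]
    generalize pairRoot (i, k) = g at *
    beta_reduce at *
    grind

theorem exists_cascade_typeA (h : EuclideanSpace ℝ (Fin N)) (hanti : ∀ i j, i ≤ j → h j ≤ h i)
    (A : Finset (Fin N)) :
    ∃ L, Cascade h (((A ×ˢ A).filter fun p ↦ p.1 < p.2).image pairRoot) L := by
  induction A using Finset.strongInduction with
  | _ A ih =>
  have hlt : ∀ i k, i ∈ A → (A.erase i).erase k ⊂ A := fun i k hi ↦
    (Finset.erase_subset _ _).trans_ssubset (Finset.erase_ssubset hi)
  by_cases hA : A.Nontrivial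
  swap
  · refine ⟨[], ?_⟩
    have : ((A ×ˢ A).filter fun p ↦ p.1 < p.2) = ∅ := by
      rw [Finset.filter_eq_empty_iff]
      rintro ⟨j, l⟩ hp hjl
      rw [Finset.mem_product] at hp
      exact hA ⟨j, hp.1, l, hp.2, hjl.ne⟩
    rw [this, Finset.image_empty]
    exact .nil
  by_cases hinj : ∃ j ∈ A, ∃ l ∈ A, j < l ∧ h j = h l
  · obtain ⟨j, hj, l, hl, hjl, hh⟩ := hinj
    set T := A.filter fun m ↦ h m = h j with hT
    have hjT : j ∈ T := by simp [hT, hj]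
    have hlT : l ∈ T := by simp [hT, hl, hh]
    obtain ⟨i, hi, hi'⟩ : ∃ i ∈ T, ∀ m ∈ T, i ≤ m :=
      ⟨T.min' ⟨j, hjT⟩, T.min'_mem _, fun m hm ↦ T.min'_le m hm⟩
    obtain ⟨k, hk, hk'⟩ : ∃ k ∈ T, ∀ m ∈ T, m ≤ k :=
      ⟨T.max' ⟨j, hjT⟩, T.max'_mem _, fun m hm ↦ T.le_max' m hm⟩
    have hik : i < k := (hi' j hjT).trans_lt (hjl.trans_le (hk' l hlT))
    simp only [hT, Finset.mem_filter] at hi hk hi' hk'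
    refine Cascade.exists_cons_typeA hi.1 hk.1 hik (fun m hm hmi hmk ↦ ?_) (ih _ (hlt i k hi.1))
    rw [hi.2, hk.2, and_self]
    refine ⟨fun hm' ↦ ?_, fun hm' ↦ ⟨lt_of_le_of_ne (hi' m ⟨hm, hm'⟩) hmi.symm,
      lt_of_le_of_ne (hk' m ⟨hm, hm'⟩) hmk⟩⟩
    have h1 := hanti _ _ hm'.1.le
    have h2 := hanti _ _ hm'.2.le
    linarith [hi.2, hk.2]
  · push Not at hinj
    obtain ⟨i, hi, hi'⟩ : ∃ i ∈ A, ∀ m ∈ A, i ≤ m :=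
      ⟨A.min' hA.nonempty, A.min'_mem _, fun m hm ↦ A.min'_le m hm⟩
    have hne : (A.erase i).Nonempty := by
      obtain ⟨k, hk, hki⟩ := hA.exists_ne i
      exact ⟨k, Finset.mem_erase.2 ⟨hki, hk⟩⟩
    obtain ⟨k, hk, hk'⟩ : ∃ k ∈ A.erase i, ∀ m ∈ A.erase i, k ≤ m :=
      ⟨(A.erase i).min' hne, Finset.min'_mem _ _, fun m hm ↦ Finset.min'_le _ m hm⟩
    rw [Finset.mem_erase] at hk
    have hik : i < k := lt_of_le_of_ne (hi' k hk.2) hk.1.symm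
    refine Cascade.exists_cons_typeA hi hk.2 hik (fun m hm hmi hmk ↦ ?_) (ih _ (hlt i k hi))
    have hkm : k < m := lt_of_le_of_ne (hk' m (Finset.mem_erase.2 ⟨hmi, hm⟩)) hmk.symm
    have h1 := hinj i hi m hm (hik.trans hkm)
    have h2 := hinj k hk.2 m hm hkm
    constructor <;> constructor
    · exact fun h' ↦ absurd h'.2 hkm.not_gt
    · exact fun h' ↦ absurd h'.symm h1
    · exact fun h' ↦ absurd h'.2 hkm.not_gt
    · exact fun h' ↦ absurd h'.symm h2

end ExistsCascade

section ExistsCascadeTypeC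

variable {N : ℕ}

theorem Cascade.exists_cons_typeC {h : EuclideanSpace ℝ (Fin N)} {A : Finset (Fin N)} {a : Fin N}
    (ha : a ∈ A) (H : ∀ m ∈ A, m ≠ a → (a < m ↔ h m = h a) ∧ (a < m ↔ h m + h a = 0))
    (htail : ∃ L, Cascade h ((A.erase a ×ˢ A.erase a).image pairRoot) L) :
    ∃ L, Cascade h ((A ×ˢ A).image pairRoot) L := by
  obtain ⟨L, hL⟩ := htail
  have hga : pairRoot (a, a) a = 2 := by
    simp only [pairRoot_apply, lt_irrefl, if_true, if_false]
    norm_num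
  have hg : ∀ m, m ≠ a → pairRoot (a, a) m = 0 := fun m h1 ↦ by simp [pairRoot_apply, h1]
  refine ⟨_, .cons_image (q := (a, a)) (by simp [ha]) ?_ ?_ ?_ ?_ hL⟩
  · rintro ⟨j, l⟩ hp
    simp only [Finset.mem_product] at hp
    rw [inner_pairRoot, inner_pairRoot]
    generalize pairRoot (a, a) = g at *
    beta_reduce at *
    grind
  · rw [inner_pairRoot_of_le _ le_rfl]
    rintro hne ⟨j, l⟩ hp
    simp only [Finset.mem_product] at hp
    rw [inner_pairRoot, inner_pairRoot]
    generalize pairRoot (a, a) = g at *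
    beta_reduce at *
    grind
  · rw [sum_product_eq_of_erase ha]
    · rw [excess_of_pos (by rw [inner_pairRoot_of_le _ le_rfl, hga]; norm_num)]
      split_ifs <;> simp
    · intro m hm
      simp only [Finset.mem_erase] at hm
      have hgm := hg m hm.1
      obtain ⟨h1, h2⟩ := H m hm.2 hm.1
      rcases lt_or_gt_of_ne hm.1 with hma | hma
      · rw [excess_of_pos (by rw [inner_pairRoot_of_le _ hma.le, hga, hgm]; norm_num),
          excess_of_neg (by rw [inner_pairRoot_of_lt _ hma, hga, hgm]; norm_num),
          inner_pairRoot_of_le _ hma.le, inner_pairRoot_of_lt _ hma]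
        beta_reduce at *
        grind
      · rw [excess_of_pos (by rw [inner_pairRoot_of_lt _ hma, hga, hgm]; norm_num),
          excess_of_pos (by rw [inner_pairRoot_of_le _ hma.le, hga, hgm]; norm_num),
          inner_pairRoot_of_le _ hma.le, inner_pairRoot_of_lt _ hma]
        beta_reduce at *
        grind
    · intro m hm m' hm'
      simp only [Finset.mem_erase] at hm hm'
      rw [excess_of_eq_zero]
      simp [inner_pairRoot, hg m hm.1, hg m' hm'.1]
  · ext ⟨j, l⟩
    simp only [Finset.mem_filter, Finset.mem_product, Finset.mem_erase]
    rw [inner_pairRoot]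
    generalize pairRoot (a, a) = g at *
    beta_reduce at *
    grind

theorem Cascade.exists_cons_cons_typeC {h : EuclideanSpace ℝ (Fin N)} {A : Finset (Fin N)}
    {i k : Fin N} (hi : i ∈ A) (hk : k ∈ A) (hik : i < k) (hhik : h i = h k)
    (hmax : ∀ m ∈ A, m ≤ k) (hpos : ∀ m ∈ A, 0 < h m) (H : ∀ m ∈ A, m < i ↔ h m ≠ h i)
    (htail : ∃ L, Cascade h ((((A.erase i).erase k) ×ˢ ((A.erase i).erase k)).image pairRoot) L) :
    ∃ L, Cascade h ((A ×ˢ A).image pairRoot) L := by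
  obtain ⟨L, hL⟩ := htail
  have hposi := hpos i hi
  have hposk := hpos k hk
  have hfi : pairRoot (k, i) i = 1 := by simp [pairRoot_apply, hik.ne, hik.not_gt]
  have hfk : pairRoot (k, i) k = 1 := by simp [pairRoot_apply, hik.ne']
  have hf : ∀ m, m ≠ i → m ≠ k → pairRoot (k, i) m = 0 := fun m h1 h2 ↦ by
    simp [pairRoot_apply, h1, h2]
  have hL' : Cascade h ((insert (k, i) (((A.erase i).erase k) ×ˢ ((A.erase i).erase k))).image
      pairRoot) (pairRoot (k, i) :: L) := by
    have horth : ∀ p ∈ ((A.erase i).erase k) ×ˢ ((A.erase i).erase k),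
        ⟪pairRoot (k, i), pairRoot p⟫_ℝ = 0 := by
      intro p hp
      simp only [Finset.mem_product, Finset.mem_erase] at hp
      simp [inner_pairRoot, hf p.1 hp.1.2.1 hp.1.1, hf p.2 hp.2.2.1 hp.2.1]
    have hself : 0 < ⟪pairRoot (k, i), pairRoot (k, i)⟫_ℝ := by
      rw [inner_pairRoot_of_le _ hik.le, hfi, hfk]
      norm_num
    have hhne : ⟪h, pairRoot (k, i)⟫_ℝ ≠ 0 := by
      rw [inner_pairRoot_of_le _ hik.le]
      exact (add_pos hposk hposi).ne'
    refine .cons_image (q := (k, i)) (Finset.mem_insert_self _ _) ?_ ?_ ?_ ?_ hL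
    · intro p hp _
      rcases Finset.mem_insert.1 hp with rfl | hp
      · exact hself.le
      · exact (horth p hp).ge
    · intro _ p hp h0
      rcases Finset.mem_insert.1 hp with rfl | hp
      · exact absurd h0 hhne
      · exact horth p hp
    · rw [Finset.sum_insert (by simp), Finset.sum_eq_zero fun p hp ↦ excess_of_eq_zero (horth p hp),
        excess_of_pos hself, if_neg hhne, if_neg hhne]
      norm_num
    · rw [Finset.filter_insert, if_neg hself.ne', Finset.filter_true_of_mem horth]
  have hgi : pairRoot (i, k) i = 1 := by simp [pairRoot_apply, hik.ne]
  have hgk : pairRoot (i, k) k = -1 := by simp [pairRoot_apply, hik.ne', hik]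
  have hg : ∀ m, m ≠ i → m ≠ k → pairRoot (i, k) m = 0 := fun m h1 h2 ↦ by
    simp [pairRoot_apply, h1, h2]
  clear hfi hfk hf
  refine ⟨_, .cons_image (q := (i, k)) (by simp [hi, hk]) ?_ ?_ ?_ ?_ hL'⟩
  · rintro ⟨j, l⟩ hp
    simp only [Finset.mem_product] at hp
    rw [inner_pairRoot, inner_pairRoot]
    generalize pairRoot (i, k) = g at *
    have h1 := hpos j hp.1
    have h2 := hpos l hp.2
    have h3 := hmax j hp.1
    have h4 := hmax l hp.2
    have h5 := H j hp.1
    have h6 := H l hp.2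
    clear hL hL' hmax hpos H
    beta_reduce at *
    grind
  · rw [inner_pairRoot_of_lt _ hik]
    exact fun hne ↦ absurd (sub_eq_zero.2 hhik) hne
  · rw [sum_product_eq_of_erase_erase hi (Finset.mem_erase.2 ⟨hik.ne', hk⟩)]
    · rw [excess_of_pos (p := (i, i)) (by rw [inner_pairRoot_of_le _ le_rfl, hgi]; norm_num),
        excess_of_pos (p := (i, k)) (by rw [inner_pairRoot_of_lt _ hik, hgi, hgk]; norm_num),
        excess_of_eq_zero (p := (k, i)) (by rw [inner_pairRoot_of_le _ hik.le, hgi, hgk]; norm_num),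
        excess_of_neg (p := (k, k)) (by rw [inner_pairRoot_of_le _ le_rfl, hgk]; norm_num),
        inner_pairRoot_of_le _ le_rfl, inner_pairRoot_of_le _ le_rfl, inner_pairRoot_of_lt _ hik,
        if_neg (add_pos hposi hposi).ne', if_neg (add_pos hposk hposk).ne',
        if_pos (sub_eq_zero.2 hhik), if_pos (sub_eq_zero.2 hhik)]
      norm_num
    · intro m hm
      simp only [Finset.mem_erase] at hm
      have hgm := hg m hm.2.1 hm.1
      have hmk := lt_of_le_of_ne (hmax m hm.2.2) hm.1
      have hposm := hpos m hm.2.2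
      have hHm := H m hm.2.2
      rw [excess_of_pos (p := (m, k)) (by rw [inner_pairRoot_of_lt _ hmk, hgk, hgm]; norm_num),
        excess_of_neg (p := (k, m)) (by rw [inner_pairRoot_of_le _ hmk.le, hgk, hgm]; norm_num),
        inner_pairRoot_of_lt _ hmk, inner_pairRoot_of_le _ hmk.le, if_neg (add_pos hposk hposm).ne']
      rcases lt_or_gt_of_ne hm.2.1 with hmi | hmi
      · have hne : h m ≠ h k := hhik ▸ hHm.1 hmi
        rw [excess_of_pos (p := (i, m)) (by rw [inner_pairRoot_of_le _ hmi.le, hgi, hgm]; norm_num),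
          excess_of_neg (p := (m, i)) (by rw [inner_pairRoot_of_lt _ hmi, hgi, hgm]; norm_num),
          inner_pairRoot_of_lt _ hmi, inner_pairRoot_of_le _ hmi.le,
          if_neg (add_pos hposi hposm).ne', if_neg (sub_ne_zero.2 (hHm.1 hmi)),
          if_neg (sub_ne_zero.2 hne)]
        norm_num
      · have heq : h m = h i := by
          by_contra h'
          exact hmi.not_gt (hHm.2 h')
        rw [excess_of_pos (p := (i, m)) (by rw [inner_pairRoot_of_lt _ hmi, hgi, hgm]; norm_num),
          excess_of_pos (p := (m, i)) (by rw [inner_pairRoot_of_le _ hmi.le, hgi, hgm]; norm_num),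
          inner_pairRoot_of_lt _ hmi, inner_pairRoot_of_le _ hmi.le,
          if_neg (add_pos hposm hposi).ne', if_pos (sub_eq_zero.2 heq.symm),
          if_pos (sub_eq_zero.2 (heq.trans hhik))]
        norm_num
    · intro m hm m' hm'
      simp only [Finset.mem_erase] at hm hm'
      rw [excess_of_eq_zero]
      simp [inner_pairRoot, hg m hm.2.1 hm.1, hg m' hm'.2.1 hm'.1]
  · ext ⟨j, l⟩
    simp only [Finset.mem_filter, Finset.mem_product, Finset.mem_erase, Finset.mem_insert,
      Prod.mk.injEq]
    rw [inner_pairRoot]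
    generalize pairRoot (i, k) = g at *
    have h1 := hmax j
    have h2 := hmax l
    clear hL hL' hmax hpos H
    beta_reduce at *
    grind

theorem exists_cascade_typeC (h : EuclideanSpace ℝ (Fin N)) (hanti : ∀ i j, i ≤ j → h j ≤ h i)
    (hnonneg : ∀ i, 0 ≤ h i) (A : Finset (Fin N)) :
    ∃ L, Cascade h ((A ×ˢ A).image pairRoot) L := by
  induction A using Finset.strongInduction with
  | _ A ih =>
  rcases A.eq_empty_or_nonempty with rfl | hA
  · exact ⟨[], by simpa using Cascade.nil⟩
  by_cases hzero : ∃ m ∈ A, h m = 0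
  · obtain ⟨m, hm, hm0⟩ := hzero
    have hne : (A.filter fun m ↦ h m = 0).Nonempty := ⟨m, by simp [hm, hm0]⟩
    obtain ⟨a, ha, ha'⟩ : ∃ a ∈ A.filter fun m ↦ h m = 0, ∀ m ∈ A.filter fun m ↦ h m = 0, a ≤ m :=
      ⟨_, Finset.min'_mem _ hne, fun m hm ↦ Finset.min'_le _ m hm⟩
    simp only [Finset.mem_filter] at ha ha'
    refine Cascade.exists_cons_typeC ha.1 (fun m hm hma ↦ ?_) (ih _ (Finset.erase_ssubset ha.1))
    rw [ha.2, add_zero, and_self]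
    exact ⟨fun h' ↦ le_antisymm (ha.2 ▸ hanti _ _ h'.le) (hnonneg m),
      fun h' ↦ lt_of_le_of_ne (ha' m ⟨hm, h'⟩) hma.symm⟩
  push Not at hzero
  have hpos : ∀ m ∈ A, 0 < h m := fun m hm ↦ lt_of_le_of_ne (hnonneg m) (hzero m hm).symm
  obtain ⟨k, hk, hk'⟩ : ∃ k ∈ A, ∀ m ∈ A, m ≤ k :=
    ⟨A.max' hA, A.max'_mem _, fun m hm ↦ A.le_max' m hm⟩
  by_cases hblock : ∃ j ∈ A, j < k ∧ h j = h k
  · obtain ⟨j, hj, hjk, hhj⟩ := hblock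
    have hne : (A.filter fun m ↦ h m = h k).Nonempty := ⟨j, by simp [hj, hhj]⟩
    obtain ⟨i, hi, hi'⟩ : ∃ i ∈ A.filter fun m ↦ h m = h k,
        ∀ m ∈ A.filter fun m ↦ h m = h k, i ≤ m :=
      ⟨_, Finset.min'_mem _ hne, fun m hm ↦ Finset.min'_le _ m hm⟩
    simp only [Finset.mem_filter] at hi hi'
    refine Cascade.exists_cons_cons_typeC hi.1 hk ((hi' j ⟨hj, hhj⟩).trans_lt hjk) hi.2 hk' hpos
      (fun m hm ↦ ⟨fun hmi heq ↦ (hi' m ⟨hm, heq.trans hi.2⟩).not_gt hmi, fun hne ↦ ?_⟩)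
      (ih _ ((Finset.erase_subset _ _).trans_ssubset (Finset.erase_ssubset hi.1)))
    by_contra! him
    exact hne (le_antisymm (hanti _ _ him) (hi.2 ▸ hanti _ _ (hk' m hm)))
  · push Not at hblock
    refine Cascade.exists_cons_typeC hk (fun m hm hmk ↦ ?_) (ih _ (Finset.erase_ssubset hk))
    have hlt : m < k := lt_of_le_of_ne (hk' m hm) hmk
    exact ⟨iff_of_false hlt.not_gt (hblock m hm hlt),
      iff_of_false hlt.not_gt (add_pos (hpos m hm) (hpos k hk)).ne'⟩

end ExistsCascadeTypeC

section RootSystems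

theorem rank_two_of_inner {V : Type*} [NormedAddCommGroup V] [InnerProductSpace ℝ V] {α β : V}
    {m : ℕ} (h : m = 2 ∧ ⟪α, β⟫_ℝ = 0 ∨
      m = 3 ∧ ⟪α, α⟫_ℝ = 2 ∧ ⟪β, β⟫_ℝ = 2 ∧ ⟪α, β⟫_ℝ = -1 ∨
      m = 4 ∧ ⟪α, α⟫_ℝ = 2 ∧ ⟪β, β⟫_ℝ = 4 ∧ ⟪α, β⟫_ℝ = -2 ∨
      m = 4 ∧ ⟪α, α⟫_ℝ = 4 ∧ ⟪β, β⟫_ℝ = 2 ∧ ⟪α, β⟫_ℝ = -2) :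
    ∃ a b : ℝ, rootRefl α β = β + a • α ∧ rootRefl β α = α + b • β ∧
      (m = 2 ∧ a = 0 ∧ b = 0 ∨ m = 3 ∧ a = 1 ∧ b = 1 ∨ m = 4 ∧ 0 < a ∧ 0 < b ∧ a * b = 2) := by
  refine ⟨-(2 / ⟪α, α⟫_ℝ * ⟪α, β⟫_ℝ), -(2 / ⟪β, β⟫_ℝ * ⟪α, β⟫_ℝ), ?_, ?_, ?_⟩
  · rw [rootRefl_apply, neg_smul, sub_eq_add_neg]
  · rw [rootRefl_apply, neg_smul, sub_eq_add_neg, real_inner_comm α β]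
  · rcases h with ⟨rfl, h⟩ | ⟨rfl, h1, h2, h3⟩ | ⟨rfl, h1, h2, h3⟩ | ⟨rfl, h1, h2, h3⟩
    · simp [h]
    all_goals rw [h1, h2, h3]; norm_num

variable {N : ℕ}

theorem rootRefl_pairRoot_apply {a b : Fin N} (hab : a < b) (v : EuclideanSpace ℝ (Fin N))
    (m : Fin N) : rootRefl (pairRoot (a, b)) v m = v (Equiv.swap a b m) := by
  have h1 : ⟪pairRoot (a, b), pairRoot (a, b)⟫_ℝ = 2 := by
    rw [inner_pairRoot_of_lt _ hab, pairRoot_apply, pairRoot_apply]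
    simp [hab, hab.ne, hab.ne']
    norm_num
  rw [rootRefl_apply, h1, real_inner_comm, inner_pairRoot_of_lt _ hab, PiLp.sub_apply,
    PiLp.smul_apply, pairRoot_apply]
  rcases eq_or_ne m a with rfl | hma
  · simp [hab.ne]
  rcases eq_or_ne m b with rfl | hmb
  · simp [hab, hab.ne']
  · simp [hma, hmb, Equiv.swap_apply_of_ne_of_ne]

theorem rootRefl_pairRoot_self_apply (a : Fin N) (v : EuclideanSpace ℝ (Fin N))
    (m : Fin N) : rootRefl (pairRoot (a, a)) v m = if m = a then -v m else v m := by
  have h1 : ⟪pairRoot (a, a), pairRoot (a, a)⟫_ℝ = 4 := by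
    rw [inner_pairRoot_of_le _ le_rfl, pairRoot_apply]
    simp
    norm_num
  rw [rootRefl_apply, h1, real_inner_comm, inner_pairRoot_of_le _ le_rfl, PiLp.sub_apply,
    PiLp.smul_apply, pairRoot_apply]
  rcases eq_or_ne m a with rfl | h
  · simp only [lt_irrefl, if_true, if_false, smul_eq_mul]
    ring
  · simp [h]

theorem swap_lt_swap {a b j l : Fin N} (hab : (a : ℕ) + 1 = b) (hjl : j < l)
    (hne : (j, l) ≠ (a, b)) : Equiv.swap a b j < Equiv.swap a b l := by
  simp only [ne_eq, Prod.mk.injEq, Fin.ext_iff, Fin.lt_def] at hjl hne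
  simp only [Equiv.swap_apply_def, Fin.ext_iff]
  split_ifs <;> rw [Fin.lt_def] <;> omega

theorem rootRefl_pairRoot_of_lt {a b j l : Fin N} (hab : (a : ℕ) + 1 = b) (hjl : j < l)
    (hne : (j, l) ≠ (a, b)) : rootRefl (pairRoot (a, b)) (pairRoot (j, l)) =
      pairRoot (Equiv.swap a b j, Equiv.swap a b l) := by
  ext m
  rw [rootRefl_pairRoot_apply (Fin.lt_def.2 (by omega)), pairRoot_apply, pairRoot_apply]
  simp only [hjl, swap_lt_swap hab hjl hne, Equiv.swap_apply_eq_iff]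

theorem rootRefl_pairRoot_of_le {a b j l : Fin N} (hab : a < b) (hlj : l ≤ j) :
    ∃ p, rootRefl (pairRoot (a, b)) (pairRoot (j, l)) = pairRoot p := by
  rcases le_total (Equiv.swap a b l) (Equiv.swap a b j) with h | h
  · refine ⟨(Equiv.swap a b j, Equiv.swap a b l), ?_⟩
    ext m
    rw [rootRefl_pairRoot_apply hab, pairRoot_apply, pairRoot_apply]
    simp only [hlj.not_gt, h.not_gt, Equiv.swap_apply_eq_iff, if_false]
  · refine ⟨(Equiv.swap a b l, Equiv.swap a b j), ?_⟩
    ext m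
    rw [rootRefl_pairRoot_apply hab, pairRoot_apply, pairRoot_apply]
    simp only [hlj.not_gt, h.not_gt, Equiv.swap_apply_eq_iff, if_false]
    ring

theorem rootRefl_pairRoot_self {a j l : Fin N} (ha : (a : ℕ) + 1 = N) (hne : (j, l) ≠ (a, a)) :
    ∃ p, rootRefl (pairRoot (a, a)) (pairRoot (j, l)) = pairRoot p := by
  have hmax : ∀ m, m ≠ a → m < a := fun m hm ↦ by
    have := m.isLt
    simp only [Fin.ext_iff, Fin.lt_def, ne_eq] at *
    omega
  by_cases hj : j = a
  · subst hj
    have hl : l < j := hmax l fun h ↦ hne (by rw [h])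
    refine ⟨(l, j), ?_⟩
    ext m
    rw [rootRefl_pairRoot_self_apply, pairRoot_apply, pairRoot_apply]
    by_cases hm : m = j
    · subst hm
      simp [hl, hl.ne']
    · simp [hm, hl.not_gt]
  by_cases hl : l = a
  · subst hl
    have hj' := hmax j hj
    refine ⟨(l, j), ?_⟩
    ext m
    rw [rootRefl_pairRoot_self_apply, pairRoot_apply, pairRoot_apply]
    by_cases hm : m = l
    · subst hm
      simp [hj', hj'.ne']
    · simp [hm, hj'.not_gt]
  · refine ⟨(j, l), ?_⟩
    ext m
    rw [rootRefl_pairRoot_self_apply, pairRoot_apply]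
    by_cases hm : m = a
    · subst hm
      simp [Ne.symm hj, Ne.symm hl]
    · simp [hm]

/-- A strictly decreasing positive vector. -/
noncomputable def staircase (N : ℕ) : EuclideanSpace ℝ (Fin N) :=
  WithLp.toLp 2 fun m ↦ (N : ℝ) - m

theorem inner_staircase_pos (p : Fin N × Fin N) : 0 < ⟪staircase N, pairRoot p⟫_ℝ := by
  have h1 : ((p.1 : ℕ) : ℝ) < N := by exact_mod_cast p.1.isLt
  have h2 : ((p.2 : ℕ) : ℝ) < N := by exact_mod_cast p.2.isLt
  rw [inner_pairRoot]
  simp only [staircase]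
  split_ifs with h
  · have h3 : ((p.1 : ℕ) : ℝ) < (p.2 : ℕ) := by exact_mod_cast h
    linarith
  · linarith

theorem strictAnti_of_forall_succ_lt {u : Fin N → ℝ}
    (hu : ∀ (i : ℕ) (h : i + 1 < N), u ⟨i + 1, h⟩ < u ⟨i, by omega⟩) : StrictAnti u := by
  cases N with
  | zero => exact fun i ↦ i.elim0
  | succ N => exact Fin.strictAnti_iff_succ_lt.2 fun i ↦ hu i (by omega)

/-- The positive roots of type `A`. -/
noncomputable def PositiveSystem.typeA (n : ℕ) :
    PositiveSystem (CoxeterMatrix.A n) (EuclideanSpace ℝ (Fin (n + 1))) where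
  root i := pairRoot (i.castSucc, i.succ)
  pos := ((Finset.univ ×ˢ Finset.univ).filter fun p ↦ p.1 < p.2).image pairRoot
  rho := staircase (n + 1)
  root_mem i := Finset.mem_image_of_mem _ (by simp)
  rho_pos := by
    simp only [Finset.forall_mem_image]
    exact fun p _ ↦ inner_staircase_pos p
  rootRefl_mem := by
    intro i
    simp only [Finset.forall_mem_image]
    rintro ⟨j, l⟩ hp hne
    simp only [Finset.mem_filter] at hp
    have hne' : (j, l) ≠ (i.castSucc, i.succ) := fun h ↦ hne (by rw [h])
    rw [rootRefl_pairRoot_of_lt (by simp) hp.2 hne']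
    exact Finset.mem_image_of_mem _ (by simpa using swap_lt_swap (by simp) hp.2 hne')
  inner_pos := by
    intro u hu
    simp only [Finset.forall_mem_image]
    rintro ⟨j, l⟩ hp
    simp only [Finset.mem_filter] at hp
    have hanti : StrictAnti u.ofLp := Fin.strictAnti_iff_succ_lt.2 fun i ↦ by
      have := hu i
      rw [inner_pairRoot_of_lt _ i.castSucc_lt_succ] at this
      linarith
    rw [inner_pairRoot_of_lt _ hp.2]
    exact sub_pos.2 (hanti hp.2)
  rank_two := by
    intro i j hij
    apply rank_two_of_inner
    have hij' : (i : ℕ) ≠ j := fun h ↦ hij (Fin.ext h)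
    simp only [CoxeterMatrix.A, Matrix.of_apply, inner_pairRoot, pairRoot_apply,
      Fin.ext_iff, Fin.lt_def, Fin.val_castSucc, Fin.val_succ]
    rcases eq_or_ne ((i : ℕ) + 1) j with h1 | h1
    · simp (disch := omega) only [if_pos, if_neg]
      norm_num
    rcases eq_or_ne ((j : ℕ) + 1) i with h2 | h2
    · simp (disch := omega) only [if_pos, if_neg]
      norm_num
    · simp (disch := omega) only [if_pos, if_neg]
      norm_num

/-- The simple roots of type `C`. -/
noncomputable def simpleRootC (n : ℕ) (i : Fin n) : EuclideanSpace ℝ (Fin n) :=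
  pairRoot (i, if h : (i : ℕ) + 1 < n then ⟨i + 1, h⟩ else i)

theorem simpleRootC_of_lt {n : ℕ} {i : Fin n} (h : (i : ℕ) + 1 < n) :
    simpleRootC n i = pairRoot (i, ⟨i + 1, h⟩) := by
  rw [simpleRootC, dif_pos h]

theorem simpleRootC_of_eq {n : ℕ} {i : Fin n} (h : (i : ℕ) + 1 = n) :
    simpleRootC n i = pairRoot (i, i) := by
  rw [simpleRootC, dif_neg (by omega)]

/-- The positive roots of type `C`. -/
noncomputable def PositiveSystem.typeC (n : ℕ) :
    PositiveSystem (CoxeterMatrix.B n) (EuclideanSpace ℝ (Fin n)) where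
  root := simpleRootC n
  pos := (Finset.univ ×ˢ Finset.univ).image pairRoot
  rho := staircase n
  root_mem i := Finset.mem_image_of_mem _ (by simp)
  rho_pos := by
    simp only [Finset.forall_mem_image]
    exact fun p _ ↦ inner_staircase_pos p
  rootRefl_mem := by
    intro i
    simp only [Finset.forall_mem_image]
    rintro ⟨j, l⟩ - hne
    suffices h : ∃ p, rootRefl (simpleRootC n i) (pairRoot (j, l)) = pairRoot p by
      obtain ⟨p, hp⟩ := h
      rw [hp]
      exact Finset.mem_image_of_mem _ (by simp)
    rcases (Nat.succ_le_of_lt i.isLt).lt_or_eq with h | h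
    · rw [simpleRootC_of_lt h] at hne ⊢
      rcases lt_or_ge j l with hjl | hjl
      · exact ⟨_, rootRefl_pairRoot_of_lt rfl hjl fun h ↦ hne (by rw [h])⟩
      · exact rootRefl_pairRoot_of_le (Fin.lt_def.2 (by simp)) hjl
    · rw [simpleRootC_of_eq h] at hne ⊢
      exact rootRefl_pairRoot_self h fun h ↦ hne (by rw [h])
  inner_pos := by
    intro u hu
    simp only [Finset.forall_mem_image]
    rintro ⟨j, l⟩ -
    have hanti : StrictAnti u.ofLp := strictAnti_of_forall_succ_lt fun i h ↦ by
      have := hu ⟨i, by omega⟩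
      rw [simpleRootC_of_lt (by simpa using h), inner_pairRoot_of_lt _ (Fin.lt_def.2 (by simp))]
        at this
      exact sub_pos.1 this
    have hpos : ∀ m, 0 < u m := fun m ↦ by
      have hm := m.isLt
      have := hu ⟨n - 1, by omega⟩
      rw [simpleRootC_of_eq (by simp; omega), inner_pairRoot_of_le _ le_rfl] at this
      have hle : u ⟨n - 1, by omega⟩ ≤ u m := hanti.antitone (Fin.le_def.2 (by simp; omega))
      linarith
    rcases lt_or_ge j l with hjl | hjl
    · rw [inner_pairRoot_of_lt _ hjl]
      exact sub_pos.2 (hanti hjl)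
    · rw [inner_pairRoot_of_le _ hjl]
      exact add_pos (hpos j) (hpos l)
  rank_two := by
    intro i j hij
    apply rank_two_of_inner
    have hij' : (i : ℕ) ≠ j := fun h ↦ hij (Fin.ext h)
    have hi := i.isLt
    have hj := j.isLt
    simp only [CoxeterMatrix.B, Matrix.of_apply, if_neg hij]
    rcases (Nat.succ_le_of_lt hi).lt_or_eq with hin | hin <;>
      rcases (Nat.succ_le_of_lt hj).lt_or_eq with hjn | hjn
    · rw [simpleRootC_of_lt hin, simpleRootC_of_lt hjn]
      simp only [inner_pairRoot, pairRoot_apply, Fin.ext_iff, Fin.lt_def]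
      rcases eq_or_ne ((i : ℕ) + 1) j with h1 | h1
      · simp (disch := omega) only [if_pos, if_neg]
        norm_num
      rcases eq_or_ne ((j : ℕ) + 1) i with h2 | h2
      · simp (disch := omega) only [if_pos, if_neg]
        norm_num
      · simp (disch := omega) only [if_pos, if_neg]
        norm_num
    · rw [simpleRootC_of_lt hin, simpleRootC_of_eq hjn]
      simp only [inner_pairRoot, pairRoot_apply, Fin.ext_iff, Fin.lt_def]
      rcases eq_or_ne ((i : ℕ) + 1) j with h1 | h1
      · simp (disch := omega) only [if_pos, if_neg]
        norm_num
      · simp (disch := omega) only [if_pos, if_neg]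
        norm_num
    · rw [simpleRootC_of_eq hin, simpleRootC_of_lt hjn]
      simp only [inner_pairRoot, pairRoot_apply, Fin.ext_iff, Fin.lt_def]
      rcases eq_or_ne ((j : ℕ) + 1) i with h1 | h1
      · simp (disch := omega) only [if_pos, if_neg]
        norm_num
      · simp (disch := omega) only [if_pos, if_neg]
        norm_num
    · omega

/-- The number of simple reflections outside `J` whose index is at least `m`. -/
noncomputable def height {n : ℕ} (J : Set (Fin n)) (m : ℕ) : ℝ :=
  ((Finset.univ.filter fun i : Fin n ↦ i ∉ J ∧ m ≤ i).card : ℝ)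

theorem height_anti {n : ℕ} (J : Set (Fin n)) {m m' : ℕ} (h : m ≤ m') :
    height J m' ≤ height J m := by
  refine Nat.cast_le.2 (Finset.card_le_card fun i ↦ ?_)
  simp only [Finset.mem_filter, Finset.mem_univ, true_and]
  exact fun hi ↦ ⟨hi.1, h.trans hi.2⟩

theorem height_eq_zero {n : ℕ} (J : Set (Fin n)) : height J n = 0 := by
  rw [height, Nat.cast_eq_zero, Finset.card_eq_zero, Finset.filter_eq_empty_iff]
  exact fun i _ h ↦ absurd i.isLt h.2.not_gt

theorem mem_iff_height_eq {n : ℕ} (J : Set (Fin n)) (i : Fin n) :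
    i ∈ J ↔ height J i = height J (i + 1) := by
  have hsub : (Finset.univ.filter fun j : Fin n ↦ j ∉ J ∧ (i : ℕ) + 1 ≤ j) ⊆
      Finset.univ.filter fun j : Fin n ↦ j ∉ J ∧ (i : ℕ) ≤ j := by
    intro j
    simp only [Finset.mem_filter, Finset.mem_univ, true_and]
    exact fun hj ↦ ⟨hj.1, by omega⟩
  rw [height, height, Nat.cast_inj]
  refine ⟨fun hi ↦ ?_, fun h ↦ ?_⟩
  · refine congrArg Finset.card (hsub.antisymm' fun j ↦ ?_)
    simp only [Finset.mem_filter, Finset.mem_univ, true_and]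
    refine fun hj ↦ ⟨hj.1, lt_of_le_of_ne hj.2 fun h ↦ hj.1 ?_⟩
    rwa [← Fin.ext h]
  · by_contra hi
    have hmem : i ∈ Finset.univ.filter fun j : Fin n ↦ j ∉ J ∧ (i : ℕ) ≤ j := by simp [hi]
    rw [← Finset.eq_of_subset_of_card_le hsub h.le] at hmem
    simp at hmem

end RootSystems

/-- Let `W` be an irreducible Weyl group of Cartan type `Aₙ`, `Bₙ` or `Cₙ` (the Coxeter
matrices of types `Bₙ` and `Cₙ` coincide) and let `J ⊆ S` be any subset of the simple
reflections. Then there exists `x ∈ ^J W` with `x ≤ x w₀` in the Bruhat order and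
`ℓ(x) = ½ [(ℓ(w₀) − ℓ_R(w₀)) − (ℓ(w_J) − ℓ_R(w_J))]`. -/
theorem stmt8 (n : ℕ) {W : Type*} [Group W] {M : CoxeterMatrix (Fin n)}
    (cs : CoxeterSystem M W)
    (hM : M = CoxeterMatrix.Aₙ n ∨ M = CoxeterMatrix.Bₙ n)
    (J : Set (Fin n))
    (w0 : W) (hw0 : cs.IsLongestOf Set.univ w0)
    (wJ : W) (hwJ : cs.IsLongestOf J wJ) :
    ∃ x : W, cs.IsMinRep J x ∧ cs.bruhatLE x (x * w0) ∧
      (2 * cs.length x : ℤ)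
        = ((cs.length w0 : ℤ) - (cs.reflLen w0 : ℤ))
          - ((cs.length wJ : ℤ) - (cs.reflLen wJ : ℤ)) := by
  rcases hM with rfl | rfl
  · have hanti : ∀ i j : Fin (n + 1), i ≤ j → height J j ≤ height J i :=
      fun i j hij ↦ height_anti J hij
    obtain ⟨L, hL⟩ := exists_cascade_typeA
      (WithLp.toLp 2 fun m : Fin (n + 1) ↦ height J m) hanti Finset.univ
    refine (PositiveSystem.typeA n).exists_isMinRep_bruhatLE cs ?_ (fun i ↦ ?_) hL hw0 hwJ
    · simp only [PositiveSystem.typeA, Finset.forall_mem_image]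
      rintro ⟨i, j⟩ hp
      have hij := (Finset.mem_filter.1 hp).2
      rw [inner_pairRoot_of_lt _ hij]
      exact sub_nonneg.2 (hanti _ _ hij.le)
    · simp only [PositiveSystem.typeA]
      rw [inner_pairRoot_of_lt _ i.castSucc_lt_succ, sub_eq_zero]
      exact mem_iff_height_eq J i
  · have hanti : ∀ i j : Fin n, i ≤ j → height J j ≤ height J i :=
      fun i j hij ↦ height_anti J hij
    have hnonneg : ∀ i : Fin n, 0 ≤ height J i := fun i ↦ Nat.cast_nonneg _
    obtain ⟨L, hL⟩ := exists_cascade_typeC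
      (WithLp.toLp 2 fun m : Fin n ↦ height J m) hanti hnonneg Finset.univ
    refine (PositiveSystem.typeC n).exists_isMinRep_bruhatLE cs ?_ (fun i ↦ ?_) hL hw0 hwJ
    · simp only [PositiveSystem.typeC, Finset.forall_mem_image]
      rintro ⟨i, j⟩ -
      rcases lt_or_ge i j with hij | hij
      · rw [inner_pairRoot_of_lt _ hij]
        exact sub_nonneg.2 (hanti _ _ hij.le)
      · rw [inner_pairRoot_of_le _ hij]
        exact add_nonneg (hnonneg i) (hnonneg j)
    · simp only [PositiveSystem.typeC]
      rw [mem_iff_height_eq]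
      rcases (Nat.succ_le_of_lt i.isLt).lt_or_eq with h | h
      · rw [simpleRootC_of_lt h, inner_pairRoot_of_lt _ (Fin.lt_def.2 (by simp)), sub_eq_zero]
      · rw [simpleRootC_of_eq h, inner_pairRoot_of_le _ le_rfl]
        rw [Nat.succ_eq_add_one] at h
        simp [h, height_eq_zero]
end

section
/- Let W be a finite Weyl group, J ⊂ S, s_j ∈ J and J' = J ∖ {s_j}. Suppose x ∈ ^J W satisfies x ≤ x·w₀ and ℓ(x) = ½[(ℓ(w₀) − ℓ_R(w₀)) − (ℓ(w_J) − ℓ_R(w_J))], and suppose i ∈ ^{J'}W_J (the minimal length representatives of the cosets W_{J'}\W_J) satisfies i < i·w_J and ℓ(i) = ½[(ℓ(w_J) − ℓ_R(w_J)) − (ℓ(w_{J'}) − ℓ_R(w_{J'}))]. Then i·x ∈ ^{J'}W, i·x ≤ i·x·w₀ in the Bruhat order, and ℓ(i·x) = ½[(ℓ(w₀) − ℓ_R(w₀)) − (ℓ(w_{J'}) − ℓ_R(w_{J'}))]. -/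
open scoped Classical

namespace CoxeterSystem

variable {B : Type*} {W : Type*} [Group W] {M : CoxeterMatrix B} (cs : CoxeterSystem M W)

/-! ### The reflection cocycle and strong exchange -/

theorem end_mul_apply {α : Type*} (f g : Function.End α) (a : α) : (f * g) a = f (g a) := rfl

/-- The action of a simple reflection on `W × ZMod 2`: conjugate the first component, and flip
the second one when the first is that simple reflection. -/
noncomputable def signedConj (i : B) : Function.End (W × ZMod 2) := fun p =>
  (cs.simple i * p.1 * cs.simple i, p.2 + if p.1 = cs.simple i then 1 else 0)

theorem signedConj_mul_pow_apply (i j : B) (k : ℕ) (t : W) (e : ZMod 2) :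
    ((cs.signedConj i * cs.signedConj j) ^ k) (t, e) =
      ((cs.simple i * cs.simple j) ^ k * t * ((cs.simple i * cs.simple j) ^ k)⁻¹,
        e + ∑ b ∈ Finset.range (2 * k),
          if t = cs.simple j * (cs.simple i * cs.simple j) ^ b then 1 else 0) := by
  induction k with
  | zero => simp; rfl
  | succ k ih =>
    have hconj : ∀ n : ℕ, ((cs.simple i * cs.simple j) ^ n)⁻¹ * cs.simple j =
        cs.simple j * (cs.simple i * cs.simple j) ^ n := by
      intro n
      have h : SemiconjBy (cs.simple j) (cs.simple i * cs.simple j)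
          (cs.simple i * cs.simple j)⁻¹ := by simp [SemiconjBy, mul_assoc]
      rw [← inv_pow]
      exact (h.pow_right n).eq.symm
    have h1 : ((cs.simple i * cs.simple j) ^ k * t * ((cs.simple i * cs.simple j) ^ k)⁻¹
        = cs.simple j) ↔ t = cs.simple j * (cs.simple i * cs.simple j) ^ (2 * k) := by
      rw [mul_inv_eq_iff_eq_mul, ← eq_inv_mul_iff_mul_eq, ← mul_assoc, hconj, mul_assoc, ← pow_add,
        two_mul]
    have h2 : (cs.simple j * ((cs.simple i * cs.simple j) ^ k * t *
        ((cs.simple i * cs.simple j) ^ k)⁻¹) * cs.simple j = cs.simple i) ↔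
          t = cs.simple j * (cs.simple i * cs.simple j) ^ (2 * k + 1) := by
      rw [← eq_mul_inv_iff_mul_eq, ← eq_inv_mul_iff_mul_eq, mul_inv_eq_iff_eq_mul,
        ← eq_inv_mul_iff_mul_eq, inv_simple, mul_assoc (cs.simple j), ← mul_assoc _⁻¹, hconj,
        mul_assoc, ← pow_succ', ← pow_add, two_mul, add_assoc]
    rw [pow_succ', end_mul_apply, ih, end_mul_apply, Nat.mul_succ, Finset.sum_range_succ, Finset.sum_range_succ]
    simp only [signedConj, h1, h2]
    refine Prod.ext ?_ ?_
    · simp [pow_succ', mul_assoc]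
    · simp [add_assoc]

theorem isLiftable_signedConj : M.IsLiftable cs.signedConj := by
  intro i j
  funext ⟨t, e⟩
  rw [cs.signedConj_mul_pow_apply, two_mul, Finset.sum_range_add]
  simp only [pow_add, cs.simple_mul_simple_pow, one_mul]
  rw [CharTwo.add_self_eq_zero]
  simp; rfl

/-- The action of `W` on `W × ZMod 2` whose second component records inversions. -/
noncomputable def signedConjHom : W →* Function.End (W × ZMod 2) :=
  cs.lift ⟨cs.signedConj, cs.isLiftable_signedConj⟩

theorem signedConjHom_wordProd (ω : List B) (t : W) (e : ZMod 2) :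
    cs.signedConjHom (cs.wordProd ω) (t, e) =
      (cs.wordProd ω * t * (cs.wordProd ω)⁻¹, e + ((cs.rightInvSeq ω).count t : ZMod 2)) := by
  induction ω with
  | nil => simp; rfl
  | cons i ω ih =>
    rw [wordProd_cons, map_mul, end_mul_apply, ih, signedConjHom,
      lift_apply_simple, signedConj, rightInvSeq, List.count_cons]
    have h : (cs.wordProd ω * t * (cs.wordProd ω)⁻¹ = cs.simple i) ↔
        (cs.wordProd ω)⁻¹ * cs.simple i * cs.wordProd ω = t := by
      rw [mul_inv_eq_iff_eq_mul, mul_assoc, inv_mul_eq_iff_eq_mul, eq_comm]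
    refine Prod.ext ?_ ?_
    · simp [mul_assoc]
    · simp [h, add_assoc]

/-- The parity of the number of occurrences of `t` in the right inversion sequence of any word
for `w`. -/
noncomputable def inversionParity (w t : W) : ZMod 2 := (cs.signedConjHom w (t, 0)).2

theorem signedConjHom_apply (w t : W) (e : ZMod 2) :
    cs.signedConjHom w (t, e) = (w * t * w⁻¹, e + cs.inversionParity w t) := by
  obtain ⟨ω, rfl⟩ := cs.wordProd_surjective w
  simp [inversionParity, signedConjHom_wordProd]

theorem inversionParity_mul (u v t : W) :
    cs.inversionParity (u * v) t =
      cs.inversionParity v t + cs.inversionParity u (v * t * v⁻¹) := by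
  rw [inversionParity, map_mul, end_mul_apply, signedConjHom_apply,
    signedConjHom_apply, zero_add]

theorem inversionParity_one (t : W) : cs.inversionParity 1 t = 0 := by
  have h := cs.inversionParity_mul 1 1 t
  simpa using h

theorem inversionParity_simple_self (i : B) :
    cs.inversionParity (cs.simple i) (cs.simple i) = 1 := by
  simp [inversionParity, signedConjHom, lift_apply_simple, signedConj]

theorem IsReflection.inversionParity_self {cs : CoxeterSystem M W} {t : W}
    (ht : cs.IsReflection t) : cs.inversionParity t t = 1 := by
  obtain ⟨u, i, rfl⟩ := ht
  have h := cs.inversionParity_mul u u⁻¹ (u * cs.simple i * u⁻¹)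
  rw [mul_inv_cancel, inversionParity_one] at h
  rw [mul_assoc u, inversionParity_mul, inversionParity_mul]
  simp only [mul_assoc, inv_mul_cancel_left, inv_inv, inv_mul_cancel, mul_one, mul_inv_rev,
    inv_simple, simple_mul_simple_cancel_left,
    inversionParity_simple_self] at h ⊢
  linear_combination -h

theorem length_mul_lt_of_inversionParity {w t : W} (h : cs.inversionParity w t = 1) :
    cs.length (w * t) < cs.length w := by
  obtain ⟨ω, hω, rfl⟩ := cs.exists_isReduced w
  refine (cs.isRightInversion_of_mem_rightInvSeq hω ?_).2
  by_contra hmem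
  simp [inversionParity, signedConjHom_wordProd, List.count_eq_zero_of_not_mem hmem] at h

theorem IsReflection.inversionParity_eq_one_iff {cs : CoxeterSystem M W} {t : W}
    (ht : cs.IsReflection t) (w : W) :
    cs.inversionParity w t = 1 ↔ cs.length (w * t) < cs.length w := by
  refine ⟨cs.length_mul_lt_of_inversionParity, fun h => ?_⟩
  by_contra hne
  have h0 : cs.inversionParity w t = 0 := by
    generalize cs.inversionParity w t = e at hne
    revert e; decide
  have h1 : cs.inversionParity (w * t) t = 1 := by
    rw [inversionParity_mul, ht.inversionParity_self, mul_inv_cancel_right, h0, add_zero]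
  have := cs.length_mul_lt_of_inversionParity h1
  rw [mul_assoc, ht.mul_self, mul_one] at this
  lia

/-- Strong exchange for a product: a right inversion of `u * v` is one of `v`, or is
conjugate under `v` to one of `u`. -/
theorem IsReflection.exchange_right {cs : CoxeterSystem M W} {t : W} (ht : cs.IsReflection t)
    {u v : W} (h : cs.length (u * v * t) < cs.length (u * v)) :
    cs.length (v * t) < cs.length v ∨ cs.length (u * (v * t * v⁻¹)) < cs.length u := by
  rw [← ht.inversionParity_eq_one_iff] at h ⊢
  rw [← (ht.conj v).inversionParity_eq_one_iff]
  rw [inversionParity_mul] at h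
  generalize cs.inversionParity v t = a at h
  generalize cs.inversionParity u (v * t * v⁻¹) = b at h
  revert a b; decide

theorem IsReflection.exchange_left {cs : CoxeterSystem M W} {t : W} (ht : cs.IsReflection t)
    {u v : W} (h : cs.length (t * (u * v)) < cs.length (u * v)) :
    cs.length (t * u) < cs.length u ∨ cs.length (u⁻¹ * t * u * v) < cs.length v := by
  have h' : cs.length (v⁻¹ * u⁻¹ * t) < cs.length (v⁻¹ * u⁻¹) := by
    rw [← cs.length_inv, ← cs.length_inv (v⁻¹ * u⁻¹)]
    simpa [ht.inv, mul_assoc] using h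
  rcases ht.exchange_right h' with h | h
  · left
    rw [← cs.length_inv, ← cs.length_inv u]
    simpa [ht.inv] using h
  · right
    rw [← cs.length_inv, ← cs.length_inv v]
    simpa [ht.inv, mul_assoc] using h

/-! ### Parabolic subgroups -/

theorem mem_parabolic_of_length_mul_lt {J : Set B} {w t : W} (hw : w ∈ cs.parabolic J)
    (ht : cs.IsReflection t) (h : cs.length (w * t) < cs.length w) : t ∈ cs.parabolic J := by
  induction hw using Subgroup.closure_induction generalizing t with
  | mem w hw =>
    obtain ⟨k, hk, rfl⟩ := hw
    rw [length_simple, Nat.lt_one_iff, length_eq_zero_iff, mul_eq_one_iff_eq_inv', inv_simple] at h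
    exact h ▸ Subgroup.subset_closure ⟨k, hk, rfl⟩
  | one => simp at h
  | mul u v hu hv ihu ihv =>
    rcases ht.exchange_right h with h | h
    · exact ihv ht h
    · have := ihu (ht.conj v) h
      have hvJ : v ∈ cs.parabolic J := hv
      simpa [mul_assoc] using
        mul_mem (mul_mem (inv_mem hvJ) this) hvJ
  | inv u hu ihu =>
    have huJ : u ∈ cs.parabolic J := hu
    have := ihu (t := u⁻¹ * t * u) (by simpa using ht.conj u⁻¹) (by
      rw [← cs.length_inv, ← cs.length_inv u]
      simpa [ht.inv, mul_assoc] using h)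
    simpa [mul_assoc] using mul_mem (mul_mem huJ this) (inv_mem huJ)

/-- Induction on an element of a parabolic subgroup along a reduced word, read from the right. -/
theorem parabolic_induction {J : Set B} {P : (w : W) → w ∈ cs.parabolic J → Prop}
    (one : P 1 (one_mem _))
    (simple_mul : ∀ k u (hk : cs.simple k ∈ cs.parabolic J) (hu : u ∈ cs.parabolic J),
      cs.length (cs.simple k * u) = cs.length u + 1 → P u hu →
        P (cs.simple k * u) (mul_mem hk hu))
    {w : W} (hw : w ∈ cs.parabolic J) : P w hw := by
  induction hn : cs.length w generalizing w with
  | zero =>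
    rw [length_eq_zero_iff] at hn
    subst hn
    exact one
  | succ n ih =>
    obtain ⟨k, hk⟩ := cs.exists_leftDescent_of_ne_one (w := w) (by rintro rfl; simp at hn)
    have hkJ : cs.simple k ∈ cs.parabolic J :=
      cs.mem_parabolic_of_length_mul_lt (inv_mem hw) (cs.isReflection_simple k)
        (cs.isRightDescent_inv_iff.mpr hk)
    rw [isLeftDescent_iff] at hk
    have hu := mul_mem hkJ hw
    have := simple_mul k _ hkJ hu (by simpa using hk.symm) (ih hu (by lia))
    simpa using this

theorem IsMinRep.length_mul {cs : CoxeterSystem M W} {J : Set B} {y : W} (hy : cs.IsMinRep J y)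
    {u : W} (hu : u ∈ cs.parabolic J) : cs.length (u * y) = cs.length u + cs.length y := by
  induction hu using cs.parabolic_induction with
  | one => simp
  | simple_mul k u hk hu hlen ih =>
    rcases cs.length_simple_mul (u * y) k with h | h
    · rw [mul_assoc]; lia
    · rcases (cs.isReflection_simple k).exchange_left (u := u) (v := y) (by lia) with h | h
      · lia
      · have := hy _ (mul_mem (mul_mem (inv_mem hu) hk) hu)
        lia

theorem IsLongestOf.length_mul {cs : CoxeterSystem M W} {J : Set B} {w : W}
    (hw : cs.IsLongestOf J w) {u : W} (hu : u ∈ cs.parabolic J) :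
    cs.length (u * w) + cs.length u = cs.length w := by
  induction hu using cs.parabolic_induction with
  | one => simp
  | simple_mul k u hk hu hlen ih =>
    have ht : cs.IsReflection (u⁻¹ * cs.simple k * u) := by
      simpa using (cs.isReflection_simple k).conj u⁻¹
    have hle := hw.2 _ (mul_mem (mul_mem (mul_mem (inv_mem hu) hk) hu) hw.1)
    have hlt := lt_of_le_of_ne hle (ht.length_mul_right_ne w)
    rcases ht.exchange_left (u := u⁻¹) (v := u * w) (by simpa using hlt) with h | h
    · rw [← cs.length_inv] at h
      simp [mul_assoc] at h
      lia
    · simp only [mul_assoc, inv_inv, mul_inv_cancel_left] at h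
      rcases cs.length_simple_mul (u * w) k with h' | h'
      · lia
      · rw [mul_assoc]; lia

/-! ### Bruhat order -/

theorem bruhatLE_simple_mul {w : W} {k : B} (h : cs.length w < cs.length (cs.simple k * w)) :
    cs.bruhatLE w (cs.simple k * w) :=
  .single ⟨⟨w⁻¹ * cs.simple k * w, by simpa using (cs.isReflection_simple k).conj w⁻¹,
    by simp [mul_assoc]⟩, h⟩

theorem IsReflection.length_simple_mul_lt_or_eq {cs : CoxeterSystem M W} {t : W}
    (ht : cs.IsReflection t) {a : W} (h : cs.length a < cs.length (a * t)) (k : B) :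
    cs.length (cs.simple k * a) < cs.length (cs.simple k * (a * t)) ∨
      cs.simple k * a = a * t := by
  have h' : cs.length (cs.simple k * (cs.simple k * (a * t)) * t) <
      cs.length (cs.simple k * (cs.simple k * (a * t))) := by
    simpa [mul_assoc, ht.mul_self] using h
  rcases ht.exchange_right h' with h | h
  · left
    simpa [mul_assoc, ht.mul_self] using h
  · right
    rw [length_simple, Nat.lt_one_iff, length_eq_zero_iff] at h
    have h' : a * (cs.simple k * (a * t))⁻¹ = 1 := by
      rw [← h]
      simp [mul_assoc, ht.mul_self, ht.inv]
    rw [mul_inv_eq_one] at h'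
    nth_rw 1 [h']
    simp

theorem bruhatLE.simple_mul_or {cs : CoxeterSystem M W} {x y : W} (h : cs.bruhatLE x y) (k : B) :
    cs.bruhatLE (cs.simple k * x) y ∨ cs.bruhatLE (cs.simple k * x) (cs.simple k * y) := by
  induction h with
  | refl => exact .inr .refl
  | tail hxa hab ih =>
    obtain ⟨⟨t, ht, rfl⟩, hlt⟩ := hab
    rcases ih with ih | ih
    · exact .inl (ih.tail ⟨⟨t, ht, rfl⟩, hlt⟩)
    · rcases ht.length_simple_mul_lt_or_eq hlt k with h | h
      · exact .inr (ih.tail ⟨⟨t, ht, by rw [mul_assoc]⟩, h⟩)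
      · exact .inl (h ▸ ih)

theorem bruhatLE.le_simple_mul_or {cs : CoxeterSystem M W} {x y : W} (h : cs.bruhatLE x y)
    (k : B) :
    cs.bruhatLE x (cs.simple k * y) ∨ cs.bruhatLE (cs.simple k * x) (cs.simple k * y) := by
  induction h with
  | refl => exact .inr .refl
  | @tail a b hxa hab ih =>
    obtain ⟨⟨t, ht, rfl⟩, hlt⟩ := hab
    rcases ht.length_simple_mul_lt_or_eq hlt k with h | h
    · exact ih.imp (·.tail ⟨⟨t, ht, by rw [mul_assoc]⟩, h⟩)
        (·.tail ⟨⟨t, ht, by rw [mul_assoc]⟩, h⟩)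
    · rw [← h, simple_mul_simple_cancel_left]
      exact .inl hxa

/-- Left multiplication by an element of a parabolic subgroup is monotone below a minimal
coset representative. -/
theorem bruhatLE.mul_left_of_isMinRep {cs : CoxeterSystem M W} {J : Set B} {x y : W}
    (h : cs.bruhatLE x y) (hy : cs.IsMinRep J y) {u : W} (hu : u ∈ cs.parabolic J) :
    cs.bruhatLE (u * x) (u * y) := by
  induction hu using cs.parabolic_induction with
  | one => simpa using h
  | simple_mul k u hk hu hlen ih =>
    have hlt : cs.length (u * y) < cs.length (cs.simple k * (u * y)) := by
      rw [← mul_assoc, hy.length_mul (mul_mem hk hu), hy.length_mul hu]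
      lia
    rw [mul_assoc, mul_assoc]
    exact (ih.simple_mul_or k).elim (·.trans (cs.bruhatLE_simple_mul hlt)) id

/-- Projecting the larger element to its minimal coset representative preserves the
relation `x ≤ y` when `x` is a minimal coset representative. -/
theorem bruhatLE.of_isMinRep {cs : CoxeterSystem M W} {J : Set B} {x y u : W}
    (hx : cs.IsMinRep J x) (hu : u ∈ cs.parabolic J)
    (h : cs.bruhatLE x (u * y)) : cs.bruhatLE x y := by
  induction hu using cs.parabolic_induction with
  | one => simpa using h
  | simple_mul k u hk hu hlen ih =>
    have hlt : cs.length x < cs.length (cs.simple k * x) :=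
      lt_of_le_of_ne (hx _ hk) (cs.length_simple_mul_ne x k).symm
    have h' := h.le_simple_mul_or k
    rw [mul_assoc, simple_mul_simple_cancel_left] at h'
    exact ih (h'.elim id (cs.bruhatLE_simple_mul hlt).trans)

/-- Right multiplication by a minimal coset representative is monotone on the
parabolic subgroup. -/
theorem bruhatLE.mul_right_of_isMinRep {cs : CoxeterSystem M W} {J : Set B} {u v x : W}
    (h : cs.bruhatLE u v) (hv : v ∈ cs.parabolic J) (hx : cs.IsMinRep J x) :
    cs.bruhatLE (u * x) (v * x) := by
  induction h with
  | refl => exact .refl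
  | @tail a b hua hab ih =>
    obtain ⟨⟨t, ht, rfl⟩, hlt⟩ := hab
    have htJ : t ∈ cs.parabolic J :=
      cs.mem_parabolic_of_length_mul_lt hv ht (by simpa [mul_assoc, ht.mul_self] using hlt)
    have ha : a ∈ cs.parabolic J := by simpa using mul_mem hv (inv_mem htJ)
    refine (ih ha).tail ⟨⟨x⁻¹ * t * x, by simpa using ht.conj x⁻¹, by simp [mul_assoc]⟩, ?_⟩
    rw [hx.length_mul ha, hx.length_mul hv]
    lia

theorem parabolic_univ : cs.parabolic Set.univ = ⊤ := by
  rw [parabolic, Set.image_univ, cs.subgroup_closure_range_simple]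

theorem parabolic_mono {J K : Set B} (h : J ⊆ K) : cs.parabolic J ≤ cs.parabolic K :=
  Subgroup.closure_mono (Set.image_mono h)

/-- If `x` is a minimal coset representative for `J`, then `x * w₀` is maximal in its coset, so
`wJ⁻¹ * (x * w₀)` is again minimal. -/
theorem IsMinRep.inv_longest_mul_mul_longest {cs : CoxeterSystem M W} {J : Set B} {w0 wJ x : W}
    (hx : cs.IsMinRep J x) (hw0 : cs.IsLongestOf Set.univ w0) (hwJ : cs.IsLongestOf J wJ) :
    cs.IsMinRep J (wJ⁻¹ * (x * w0)) := by
  intro u hu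
  have hlen : ∀ v ∈ cs.parabolic J,
      cs.length (v * (x * w0)) + (cs.length v + cs.length x) = cs.length w0 := by
    intro v hv
    rw [← hx.length_mul hv, ← mul_assoc]
    exact hw0.length_mul (by simp [parabolic_univ])
  have huw := mul_mem hu (inv_mem hwJ.1)
  have h1 := hlen _ (inv_mem hwJ.1)
  have h2 := hlen _ huw
  have h3 := hwJ.2 _ huw
  rw [cs.length_inv] at h1
  rw [← mul_assoc u]
  lia

end CoxeterSystem

/-- Let `W` be a finite Weyl group (a finite crystallographic Coxeter group), `J ⊆ S`,
`s_j ∈ J` and `J' = J ∖ {s_j}`. Suppose `x ∈ ^J W` satisfies `x ≤ x w₀` and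
`ℓ(x) = ½ [(ℓ(w₀) − ℓ_R(w₀)) − (ℓ(w_J) − ℓ_R(w_J))]`, and suppose `i ∈ ^{J'}W_J` (a
minimal length representative of its coset of `W_{J'}` in `W_J`) satisfies `i < i w_J` and
`ℓ(i) = ½ [(ℓ(w_J) − ℓ_R(w_J)) − (ℓ(w_{J'}) − ℓ_R(w_{J'}))]`. Then `i x ∈ ^{J'}W`,
`i x ≤ i x w₀` in the Bruhat order, and
`ℓ(i x) = ½ [(ℓ(w₀) − ℓ_R(w₀)) − (ℓ(w_{J'}) − ℓ_R(w_{J'}))]`. -/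
theorem stmt9 {B : Type*} {W : Type*} [Group W] [Finite W] {M : CoxeterMatrix B}
    (cs : CoxeterSystem M W)
    (hcrys : ∀ i j : B, i ≠ j → M.M i j = 2 ∨ M.M i j = 3 ∨ M.M i j = 4 ∨ M.M i j = 6)
    (J : Set B) (j : B) (hj : j ∈ J)
    (w0 : W) (hw0 : cs.IsLongestOf Set.univ w0)
    (wJ : W) (hwJ : cs.IsLongestOf J wJ)
    (wJ' : W) (hwJ' : cs.IsLongestOf (J \ {j}) wJ')
    (x : W) (hxrep : cs.IsMinRep J x) (hxle : cs.bruhatLE x (x * w0))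
    (hxlen : (2 * cs.length x : ℤ)
      = ((cs.length w0 : ℤ) - (cs.reflLen w0 : ℤ))
        - ((cs.length wJ : ℤ) - (cs.reflLen wJ : ℤ)))
    (i : W) (hiJ : i ∈ cs.parabolic J)
    (hirep : ∀ u ∈ cs.parabolic (J \ {j}), cs.length i ≤ cs.length (u * i))
    (hilt : cs.bruhatLE i (i * wJ) ∧ i ≠ i * wJ)
    (hilen : (2 * cs.length i : ℤ)
      = ((cs.length wJ : ℤ) - (cs.reflLen wJ : ℤ))
        - ((cs.length wJ' : ℤ) - (cs.reflLen wJ' : ℤ))) :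
    cs.IsMinRep (J \ {j}) (i * x) ∧ cs.bruhatLE (i * x) (i * x * w0) ∧
      (2 * cs.length (i * x) : ℤ)
        = ((cs.length w0 : ℤ) - (cs.reflLen w0 : ℤ))
          - ((cs.length wJ' : ℤ) - (cs.reflLen wJ' : ℤ)) := by
  have hlen : cs.length (i * x) = cs.length i + cs.length x := hxrep.length_mul hiJ
  refine ⟨fun u hu => ?_, ?_, by rw [hlen]; push_cast; lia⟩
  · have huJ := cs.parabolic_mono Set.sdiff_subset hu
    rw [← mul_assoc, hlen, hxrep.length_mul (mul_mem huJ hiJ)]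
    exact Nat.add_le_add_right (hirep u hu) _
  · have hiwJ := mul_mem hiJ hwJ.1
    have hy := hxrep.inv_longest_mul_mul_longest hw0 hwJ
    have hxy : cs.bruhatLE x (wJ⁻¹ * (x * w0)) :=
      .of_isMinRep hxrep hwJ.1 (by simpa using hxle)
    have hiy : i * wJ * (wJ⁻¹ * (x * w0)) = i * x * w0 := by group
    exact hiy ▸ (hilt.1.mul_right_of_isMinRep hiwJ hxrep).trans
      (hxy.mul_left_of_isMinRep hy hiwJ)
end

section
/- Let W be the Weyl group of type A_n and let J ⊂ S be a subset whose connected components, as subdiagrams of the Dynkin diagram, have types A_{n₁},…,A_{n_r}. Set p = Σᵢ ⌈nᵢ/2⌉ and I = {s_{p+1}, s_{p+2}, …, s_{n−p}}. Then w_J is conjugate in W to w₀·w_I, and ℓ_R(w₀) = ℓ_R(w_J) + ℓ_R(w_I). -/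
open scoped Classical

namespace CoxeterSystem.TypeA

open Equiv

variable {n : ℕ} {W : Type*} [Group W] (cs : CoxeterSystem (CoxeterMatrix.A n) W)

theorem matrix_apply (i j : Fin n) : (CoxeterMatrix.A n) i j =
    if i = j then 1 else if (j : ℕ) + 1 = i ∨ (i : ℕ) + 1 = j then 3 else 2 := rfl

/-- The adjacent transposition of `Fin (n + 1)` exchanging `i` and `i + 1`. -/
def adjSwap (i : Fin n) : Perm (Fin (n + 1)) := swap i.castSucc i.succ

theorem val_adjSwap (i : Fin n) (x : Fin (n + 1)) :
    (adjSwap i x : ℕ) =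
      if (x : ℕ) = i then (i : ℕ) + 1 else if (x : ℕ) = i + 1 then (i : ℕ) else x := by
  simp only [adjSwap, swap_apply_def, Fin.ext_iff, Fin.val_castSucc, Fin.val_succ]
  split_ifs <;> simp

theorem isLiftable_adjSwap : (CoxeterMatrix.A n).IsLiftable (adjSwap (n := n)) := by
  intro i j
  rw [matrix_apply]
  ext x
  simp only [Fin.ext_iff]
  split_ifs with h1 h2 <;>
  · simp only [pow_succ, pow_zero, one_mul, Perm.mul_apply, val_adjSwap, Perm.one_apply]
    grind

/-- The canonical homomorphism from the Coxeter group of type `Aₙ` to the symmetric group. -/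
noncomputable def toPerm : W →* Perm (Fin (n + 1)) := cs.lift ⟨adjSwap, isLiftable_adjSwap⟩

@[simp]
theorem toPerm_simple (i : Fin n) : toPerm cs (cs.simple i) = adjSwap i :=
  cs.lift_apply_simple isLiftable_adjSwap i

theorem toPerm_surjective : Function.Surjective (toPerm cs) := by
  rw [← MonoidHom.mrange_eq_top, ← top_le_iff, ← Perm.mclosure_swap_castSucc_succ,
    Submonoid.closure_le]
  rintro _ ⟨i, rfl⟩
  exact ⟨cs.simple i, toPerm_simple cs i⟩

/-- The simple reflections indexed by natural numbers, extended by `1`. -/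
def natSimple (k : ℕ) : W := if h : k < n then cs.simple ⟨k, h⟩ else 1

theorem natSimple_mul_self (k : ℕ) : natSimple cs k * natSimple cs k = 1 := by
  unfold natSimple
  split_ifs <;> simp

theorem natSimple_comm {k l : ℕ} (h : k + 1 < l) :
    natSimple cs k * natSimple cs l = natSimple cs l * natSimple cs k := by
  unfold natSimple
  split_ifs with hk hl
  · have h2 := cs.simple_mul_simple_pow ⟨k, hk⟩ ⟨l, hl⟩
    have hM : (CoxeterMatrix.A n) ⟨k, hk⟩ ⟨l, hl⟩ = 2 := by
      simp only [matrix_apply, Fin.mk.injEq]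
      grind
    rw [hM, pow_two, ← eq_inv_iff_mul_eq_one] at h2
    simpa using h2
  all_goals simp

theorem natSimple_braid {k : ℕ} (h : k + 1 < n) :
    natSimple cs (k + 1) * natSimple cs k * natSimple cs (k + 1) =
      natSimple cs k * natSimple cs (k + 1) * natSimple cs k := by
  have hk : k < n := by omega
  simp only [natSimple, h, hk, dif_pos]
  have h2 := cs.simple_mul_simple_pow ⟨k + 1, h⟩ ⟨k, hk⟩
  have hM : (CoxeterMatrix.A n) ⟨k + 1, h⟩ ⟨k, hk⟩ = 3 := by
    simp [matrix_apply]
  rw [hM, pow_succ, pow_two] at h2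
  have h3 : cs.simple ⟨k + 1, h⟩ * cs.simple ⟨k, hk⟩ * cs.simple ⟨k + 1, h⟩ *
      (cs.simple ⟨k, hk⟩ * cs.simple ⟨k + 1, h⟩ * cs.simple ⟨k, hk⟩) = 1 := by
    rw [← h2]; group
  rw [← eq_inv_iff_mul_eq_one] at h3
  simpa [mul_assoc] using h3

/-- The product `s_k s_{k-1} ⋯` of `d` consecutive simple reflections in descending order. -/
def descProd (k : ℕ) : ℕ → W
  | 0 => 1
  | d + 1 => descProd k d * natSimple cs (k - d)

theorem descProd_comm_low {k d j : ℕ} (h : j + d < k) :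
    descProd cs k d * natSimple cs j = natSimple cs j * descProd cs k d := by
  induction d with
  | zero => simp [descProd]
  | succ d ih =>
    rw [descProd, mul_assoc, ← natSimple_comm cs (by omega : j + 1 < k - d), ← mul_assoc,
      ih (by omega), mul_assoc]

theorem descProd_mul_high {k d i : ℕ} (hk : k < n) (hd : d ≤ k) (h1 : k ≤ i + d)
    (h2 : i + 1 ≤ k) :
    descProd cs k (d + 1) * natSimple cs (i + 1) = natSimple cs i * descProd cs k (d + 1) := by
  induction d with
  | zero => omega
  | succ d ih =>
    by_cases h : k ≤ i + d
    · rw [descProd, mul_assoc, natSimple_comm cs (by omega : k - (d + 1) + 1 < i + 1),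
        ← mul_assoc, ih (by omega) h, mul_assoc]
    · obtain rfl : k = i + 1 + d := by omega
      rw [descProd, descProd, show i + 1 + d - d = i + 1 by omega,
        show i + 1 + d - (d + 1) = i by omega]
      calc _ = descProd cs (i + 1 + d) d *
            (natSimple cs (i + 1) * natSimple cs i * natSimple cs (i + 1)) := by
            simp only [mul_assoc]
        _ = descProd cs (i + 1 + d) d * natSimple cs i *
            (natSimple cs (i + 1) * natSimple cs i) := by
            rw [natSimple_braid cs (by omega)]; simp only [mul_assoc]
        _ = _ := by
            rw [descProd_comm_low cs (by omega)]; simp only [mul_assoc]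

/-- The parabolic subgroup generated by the first `k` simple reflections. -/
def initialParabolic (k : ℕ) : Subgroup W := Subgroup.closure (natSimple cs '' Set.Iio k)

theorem natSimple_mem_initialParabolic {i k : ℕ} (h : i < k) :
    natSimple cs i ∈ initialParabolic cs k :=
  Subgroup.subset_closure ⟨i, h, rfl⟩

theorem exists_eq_mul_descProd {k : ℕ} (hk : k < n) {w : W}
    (hw : w ∈ initialParabolic cs (k + 1)) :
    ∃ u ∈ initialParabolic cs k, ∃ d ≤ k + 1, w = u * descProd cs k d := by
  have step : ∀ w : W, ∀ i ≤ k,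
      (∃ u ∈ initialParabolic cs k, ∃ d ≤ k + 1, w = u * descProd cs k d) →
      ∃ u ∈ initialParabolic cs k, ∃ d ≤ k + 1, w * natSimple cs i = u * descProd cs k d := by
    rintro _ i hi ⟨u, hu, d, hd, rfl⟩
    rcases lt_trichotomy (i + d) k with h | h | h
    · exact ⟨u * natSimple cs i, mul_mem hu (natSimple_mem_initialParabolic cs (by omega)), d, hd,
        by rw [mul_assoc, descProd_comm_low cs h, mul_assoc]⟩
    · exact ⟨u, hu, d + 1, by omega, by
        rw [descProd, mul_assoc, show k - d = i by omega]⟩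
    · obtain ⟨e, rfl⟩ : ∃ e, d = e + 1 := ⟨d - 1, by omega⟩
      by_cases h' : i + e = k
      · exact ⟨u, hu, e, by omega, by
          rw [descProd, show k - e = i by omega, mul_assoc, mul_assoc, natSimple_mul_self,
            mul_one]⟩
      · obtain ⟨j, rfl⟩ : ∃ j, i = j + 1 := ⟨i - 1, by omega⟩
        exact ⟨u * natSimple cs j, mul_mem hu (natSimple_mem_initialParabolic cs (by omega)),
          e + 1, hd, by
            rw [mul_assoc, descProd_mul_high cs hk (by omega) (by omega) hi, mul_assoc]⟩
  induction hw using Subgroup.closure_induction_right with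
  | one => exact ⟨1, one_mem _, 0, by omega, by simp [descProd]⟩
  | mul_right x hx y hy ih =>
    obtain ⟨i, hi, rfl⟩ := hy
    exact step x i (Nat.lt_succ_iff.mp hi) ih
  | mul_inv_cancel x hx y hy ih =>
    obtain ⟨i, hi, rfl⟩ := hy
    rw [inv_eq_of_mul_eq_one_right (natSimple_mul_self cs i)]
    exact step x i (Nat.lt_succ_iff.mp hi) ih

theorem toPerm_natSimple {k : ℕ} (hk : k < n) :
    toPerm cs (natSimple cs k) = adjSwap ⟨k, hk⟩ := by
  simp [natSimple, hk]

theorem toPerm_descProd_apply {k : ℕ} (hk : k < n) (d : ℕ) (hd : d ≤ k + 1)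
    (x : Fin (n + 1)) (hx : (x : ℕ) + d = k + 1) :
    (toPerm cs (descProd cs k d) x : ℕ) = k + 1 := by
  induction d generalizing x with
  | zero => simpa [descProd] using hx
  | succ d ih =>
    rw [descProd, map_mul, Perm.mul_apply]
    apply ih (by omega)
    rw [toPerm_natSimple cs (by omega), val_adjSwap, if_pos (by simp only; omega)]
    simp only
    omega

theorem toPerm_apply_of_mem_initialParabolic {k : ℕ} (hk : k ≤ n) {w : W}
    (hw : w ∈ initialParabolic cs k) (x : Fin (n + 1)) (hx : k < (x : ℕ)) :
    toPerm cs w x = x := by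
  suffices initialParabolic cs k ≤ (MulAction.stabilizer (Perm (Fin (n + 1))) x).comap
      (toPerm cs) from this hw
  rw [initialParabolic, Subgroup.closure_le]
  rintro _ ⟨i, hi, rfl⟩
  have hi : i < k := hi
  simp only [Subgroup.coe_comap, Set.mem_preimage, SetLike.mem_coe, MulAction.mem_stabilizer_iff,
    Perm.smul_def, toPerm_natSimple cs (hi.trans_le hk), Fin.ext_iff, val_adjSwap]
  grind

theorem eq_one_of_mem_initialParabolic {k : ℕ} (hk : k ≤ n) {w : W}
    (hw : w ∈ initialParabolic cs k) (h : toPerm cs w = 1) : w = 1 := by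
  induction k generalizing w with
  | zero => simpa [initialParabolic] using hw
  | succ k ih =>
    obtain ⟨u, hu, d, hd, rfl⟩ := exists_eq_mul_descProd cs hk hw
    have hC := toPerm_descProd_apply cs hk d hd ⟨k + 1 - d, by omega⟩ (by simp only; omega)
    have hfix := toPerm_apply_of_mem_initialParabolic cs (by omega) hu
      (toPerm cs (descProd cs k d) ⟨k + 1 - d, by omega⟩) (by omega)
    rw [← Perm.mul_apply, ← map_mul, h, Perm.one_apply] at hfix
    obtain rfl : d = 0 := by
      rw [← hfix] at hC
      simp only at hC
      omega
    rw [descProd, mul_one] at h ⊢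
    exact ih (by omega) hu h

theorem toPerm_injective : Function.Injective (toPerm cs) := by
  rw [injective_iff_map_eq_one]
  refine fun w h => eq_one_of_mem_initialParabolic cs le_rfl ?_ h
  suffices initialParabolic cs n = ⊤ from this ▸ Subgroup.mem_top w
  rw [← top_le_iff, ← cs.subgroup_closure_range_simple, Subgroup.closure_le]
  rintro _ ⟨i, rfl⟩
  have := natSimple_mem_initialParabolic cs i.isLt
  rwa [natSimple, dif_pos i.isLt] at this

/-- The Coxeter group of type `Aₙ` is the symmetric group on `n + 1` letters. -/
noncomputable def permEquiv : W ≃* Perm (Fin (n + 1)) :=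
  MulEquiv.ofBijective (toPerm cs) ⟨toPerm_injective cs, toPerm_surjective cs⟩

@[simp]
theorem permEquiv_simple (i : Fin n) : permEquiv cs (cs.simple i) = adjSwap i :=
  toPerm_simple cs i

/-- The inversions of a permutation of `Fin m`. -/
def inversions {m : ℕ} (σ : Perm (Fin m)) : Finset (Fin m × Fin m) :=
  {q | q.1 < q.2 ∧ σ q.2 < σ q.1}

theorem mem_inversions {m : ℕ} {σ : Perm (Fin m)} {x y : Fin m} :
    (x, y) ∈ inversions σ ↔ x < y ∧ σ y < σ x := by
  simp [inversions]

theorem inversions_one {m : ℕ} : inversions (1 : Perm (Fin m)) = ∅ := by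
  ext ⟨x, y⟩
  simpa [mem_inversions] using fun h : x < y => h.le

theorem card_inversions_mul_adjSwap {σ : Perm (Fin (n + 1))} {i : Fin n}
    (h : σ i.castSucc < σ i.succ) :
    (inversions (σ * adjSwap i)).card = (inversions σ).card + 1 := by
  have key : inversions (σ * adjSwap i) = insert (i.castSucc, i.succ)
      ((inversions σ).map (Equiv.prodCongr (adjSwap i) (adjSwap i)).toEmbedding) := by
    ext ⟨x, y⟩
    have hs : (adjSwap i).symm = adjSwap i := symm_swap _ _
    simp only [mem_inversions, Finset.mem_insert, Finset.mem_map_equiv, Equiv.prodCongr_symm,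
      Equiv.prodCongr_apply, Prod.map, hs, Perm.mul_apply, Prod.mk.injEq]
    by_cases h1 : x = i.castSucc ∧ y = i.succ
    · obtain ⟨rfl, rfl⟩ := h1
      simpa [adjSwap] using h
    · by_cases h2 : y = i.castSucc ∧ x = i.succ
      · obtain ⟨rfl, rfl⟩ := h2
        simp [adjSwap, h.le, Fin.ext_iff]
      · have hlt : adjSwap i x < adjSwap i y ↔ x < y := by
          simp only [Fin.ext_iff, Fin.val_castSucc, Fin.val_succ] at h1 h2
          simp only [Fin.lt_def, val_adjSwap]
          grind
        simp [h1, hlt]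
  rw [key, Finset.card_insert_of_notMem, Finset.card_map]
  rw [Finset.mem_map_equiv, Equiv.prodCongr_symm, Equiv.prodCongr_apply, Prod.map, mem_inversions]
  simp only [adjSwap, symm_swap, swap_apply_left, swap_apply_right]
  exact fun h' => h'.1.asymm i.castSucc_lt_succ

theorem adjSwap_mul_self (i : Fin n) : adjSwap i * adjSwap i = 1 := swap_mul_self _ _

theorem card_inversions_mul_adjSwap_of_gt {σ : Perm (Fin (n + 1))} {i : Fin n}
    (h : σ i.succ < σ i.castSucc) :
    (inversions (σ * adjSwap i)).card + 1 = (inversions σ).card := by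
  have := card_inversions_mul_adjSwap (σ := σ * adjSwap i) (i := i) (by simpa [adjSwap] using h)
  rw [mul_assoc, adjSwap_mul_self, mul_one] at this
  exact this.symm

theorem eq_one_of_forall_lt_succ {σ : Perm (Fin (n + 1))}
    (h : ∀ i : Fin n, σ i.castSucc < σ i.succ) : σ = 1 := by
  have hm : StrictMono σ := Fin.strictMono_iff_lt_succ.mpr h
  ext x
  have := Subsingleton.elim (hm.orderIsoOfSurjective _ σ.surjective) (OrderIso.refl _)
  simpa using congrArg Fin.val (DFunLike.congr_fun this x)

theorem length_eq_card_inversions (w : W) :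
    cs.length w = (inversions (permEquiv cs w)).card := by
  apply le_antisymm
  · induction hN : (inversions (permEquiv cs w)).card generalizing w with
    | zero =>
      have : permEquiv cs w = 1 := by
        refine eq_one_of_forall_lt_succ fun i => ?_
        rcases lt_or_gt_of_ne ((permEquiv cs w).injective.ne i.castSucc_lt_succ.ne) with h | h
        · exact h
        · have := card_inversions_mul_adjSwap_of_gt h
          omega
      simp [(map_eq_one_iff _ (permEquiv cs).injective).mp this]
    | succ N ih =>
      obtain ⟨i, hi⟩ : ∃ i : Fin n, permEquiv cs w i.succ < permEquiv cs w i.castSucc := by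
        by_contra! hcon
        have : permEquiv cs w = 1 := eq_one_of_forall_lt_succ fun i =>
          (hcon i).lt_of_ne ((permEquiv cs w).injective.ne i.castSucc_lt_succ.ne)
        simp [this, inversions_one] at hN
      have h1 := card_inversions_mul_adjSwap_of_gt hi
      have h2 := ih (w * cs.simple i) (by rw [map_mul, permEquiv_simple]; omega)
      have h3 := cs.length_mul_simple w i
      omega
  · obtain ⟨ω, hω, rfl⟩ := cs.exists_isReduced w
    rw [hω.eq]
    clear hω
    induction ω using List.reverseRecOn with
    | nil => simp [inversions_one]
    | append_singleton ω i ih =>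
      rw [cs.wordProd_append, cs.wordProd_singleton, map_mul, permEquiv_simple, List.length_append,
        List.length_singleton]
      rcases lt_or_gt_of_ne
        ((permEquiv cs (cs.wordProd ω)).injective.ne i.castSucc_lt_succ.ne) with h | h
      · have := card_inversions_mul_adjSwap h
        omega
      · have := card_inversions_mul_adjSwap_of_gt h
        omega

theorem lt_of_isLongestOf {K : Set (Fin n)} {w : W} (hw : cs.IsLongestOf K w) {i : Fin n}
    (hi : i ∈ K) : permEquiv cs w i.succ < permEquiv cs w i.castSucc := by
  by_contra! hcon
  have hlt := hcon.lt_of_ne ((permEquiv cs w).injective.ne i.castSucc_lt_succ.ne)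
  have h1 := card_inversions_mul_adjSwap hlt
  have h2 := hw.2 (w * cs.simple i) (mul_mem hw.1 (Subgroup.subset_closure ⟨i, hi, rfl⟩))
  rw [length_eq_card_inversions, length_eq_card_inversions, map_mul, permEquiv_simple] at h2
  omega

/-- The letters permuted by a component of a standard parabolic subgroup of type `Aₘ` whose
first simple reflection has (one-based) label `a`. -/
def InBlock (a m x : ℕ) : Prop := a ≤ x + 1 ∧ x + 1 ≤ a + m

theorem permEquiv_apply_of_isLongestOf {r : ℕ} {a nn : Fin r → ℕ}
    (ha1 : ∀ j, 1 ≤ a j) (hend : ∀ j, a j + nn j ≤ n + 1)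
    (hsep : ∀ j j' : Fin r, (j : ℕ) < (j' : ℕ) → a j + nn j + 1 ≤ a j')
    {K : Set (Fin n)}
    (hK : ∀ i : Fin n, i ∈ K ↔ ∃ j, a j ≤ (i : ℕ) + 1 ∧ (i : ℕ) + 1 < a j + nn j)
    {w : W} (hw : cs.IsLongestOf K w) :
    (∀ (x : Fin (n + 1)) j, InBlock (a j) (nn j) x →
      (permEquiv cs w x : ℕ) + x + 2 = 2 * a j + nn j) ∧
    ∀ x : Fin (n + 1), (∀ j, ¬ InBlock (a j) (nn j) x) → permEquiv cs w x = x := by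
  have huniq : ∀ (x : ℕ) j j', InBlock (a j) (nn j) x → InBlock (a j') (nn j') x → j = j' := by
    intro x j j' h h'
    rcases lt_trichotomy (j : ℕ) j' with hlt | heq | hlt
    · have := hsep j j' hlt
      simp only [InBlock] at h h'
      omega
    · exact Fin.ext heq
    · have := hsep j' j hlt
      simp only [InBlock] at h h'
      omega
  let Rel : ℕ → ℕ → Prop := fun x y => x = y ∨ ∃ j, InBlock (a j) (nn j) x ∧ InBlock (a j) (nn j) y
  have hrel : ∀ x : Fin (n + 1), Rel x (permEquiv cs w x) := by
    have hmem := hw.1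
    clear hw
    induction hmem using Subgroup.closure_induction with
    | mem y hy =>
      obtain ⟨i, hi, rfl⟩ := hy
      obtain ⟨j, hj⟩ := (hK i).mp hi
      intro x
      rw [permEquiv_simple, val_adjSwap]
      split_ifs with h1 h2
      · exact Or.inr ⟨j, by simp only [InBlock]; omega⟩
      · exact Or.inr ⟨j, by simp only [InBlock]; omega⟩
      · exact Or.inl rfl
    | one => intro x; simp [Rel]
    | mul u v _ _ hu hv =>
      intro x
      rw [map_mul, Perm.mul_apply]
      rcases hv x with h1 | ⟨j, h1, h2⟩
      · have := hu (permEquiv cs v x)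
        rwa [← h1] at this
      · rcases hu (permEquiv cs v x) with h3 | ⟨j', h3, h4⟩
        · rw [h3] at h2
          exact Or.inr ⟨j, h1, h2⟩
        · obtain rfl := huniq _ _ _ h2 h3
          exact Or.inr ⟨j, h1, h4⟩
    | inv u _ hu =>
      intro x
      rw [map_inv]
      have := hu ((permEquiv cs u)⁻¹ x)
      rw [← Perm.mul_apply, mul_inv_cancel, Perm.one_apply] at this
      rcases this with h | ⟨j, h1, h2⟩
      · exact Or.inl h.symm
      · exact Or.inr ⟨j, h2, h1⟩
  refine ⟨fun x j hx => ?_, fun x hx => ?_⟩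
  · have hstay : ∀ y : Fin (n + 1), InBlock (a j) (nn j) y →
        InBlock (a j) (nn j) (permEquiv cs w y) := by
      intro y hy
      rcases hrel y with h | ⟨j', h1, h2⟩
      · rwa [← h]
      · rwa [huniq _ _ _ hy h1]
    have hdesc : ∀ k (h1 : a j ≤ k + 1) (h2 : k + 1 < a j + nn j),
        (permEquiv cs w ⟨k + 1, by have := hend j; omega⟩ : ℕ) <
          permEquiv cs w ⟨k, by have := hend j; omega⟩ := by
      intro k h1 h2
      have := hend j
      exact lt_of_isLongestOf cs hw (i := ⟨k, by omega⟩) ((hK _).mpr ⟨j, h1, h2⟩)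
    have hup : ∀ k (hk : a j ≤ k + 1) (hk' : k + 1 ≤ a j + nn j),
        (permEquiv cs w ⟨k, by have := hend j; omega⟩ : ℕ) + k + 2 ≤ 2 * a j + nn j := by
      intro k
      induction k with
      | zero =>
        intro hk hk'
        have := hstay ⟨0, by omega⟩ ⟨hk, hk'⟩
        have h1 := ha1 j
        simp only [InBlock] at this
        omega
      | succ k ih =>
        intro hk hk'
        by_cases h : a j ≤ k + 1
        · have h1 := ih h (by omega)
          have h2 := hdesc k h (by omega)
          omega
        · have h1 := (hstay ⟨k + 1, by have := hend j; omega⟩ ⟨hk, hk'⟩).2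
          omega
    have hlow : ∀ e k (hk : a j ≤ k + 1) (hk' : k + 1 + e = a j + nn j),
        2 * a j + nn j ≤ (permEquiv cs w ⟨k, by have := hend j; omega⟩ : ℕ) + k + 2 := by
      intro e
      induction e with
      | zero =>
        intro k hk hk'
        have h1 := (hstay ⟨k, by have := hend j; omega⟩ ⟨hk, by simp only; omega⟩).1
        omega
      | succ e ih =>
        intro k hk hk'
        have h1 := ih (k + 1) (by omega) (by omega)
        have h2 := hdesc k hk (by omega)
        omega
    exact le_antisymm (hup x hx.1 hx.2) (hlow (a j + nn j - (x + 1)) x hx.1 (by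
      have := hx.2
      omega))
  · rcases hrel x with h | ⟨j, h, -⟩
    · exact Fin.ext h.symm
    · exact absurd h (hx j)

theorem isReflection_iff_isSwap {t : W} : cs.IsReflection t ↔ (permEquiv cs t).IsSwap := by
  constructor
  · rintro ⟨w, i, rfl⟩
    rw [← Perm.card_support_eq_two, map_mul, map_mul, map_inv, Perm.card_support_conj,
      permEquiv_simple]
    exact Perm.card_support_swap i.castSucc_lt_succ.ne
  · rintro ⟨x, y, hxy, h⟩
    have hn : 0 < n := by
      by_contra h0
      obtain rfl : n = 0 := by omega
      exact hxy (Fin.ext (by omega))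
    obtain ⟨τ, hτ⟩ := isConj_iff.mp (Perm.isConj_swap (Fin.castSucc_lt_succ (i := ⟨0, hn⟩)).ne hxy)
    refine ⟨(permEquiv cs).symm τ, ⟨0, hn⟩, (permEquiv cs).injective ?_⟩
    rw [h, ← hτ, map_mul, map_mul, map_inv, MulEquiv.apply_symm_apply, permEquiv_simple, adjSwap]

theorem card_support_prod_le {m : ℕ} (l : List (Perm (Fin m))) (hl : ∀ t ∈ l, t.IsSwap) :
    l.prod.support.card ≤ 2 * l.length := by
  induction l with
  | nil => simp
  | cons t l ih =>
    have h1 := ih fun u hu => hl u (List.mem_cons_of_mem _ hu)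
    have h2 := Perm.card_support_eq_two.mpr (hl t List.mem_cons_self)
    have h3 := (Finset.card_le_card (Perm.support_mul_le t l.prod)).trans (Finset.card_union_le _ _)
    rw [List.prod_cons, List.length_cons]
    omega

theorem exists_list_isSwap_of_sq_eq_one {m : ℕ} {σ : Perm (Fin m)} (h : σ ^ 2 = 1) :
    ∃ l : List (Perm (Fin m)), (∀ t ∈ l, t.IsSwap) ∧ l.prod = σ ∧
      2 * l.length = σ.support.card := by
  obtain ⟨l, hprod, hcyc, hdisj⟩ := Perm.cycleFactors σ
  have hsupp : ∀ t ∈ l, t.support.card = 2 := by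
    intro t ht
    refine Perm.pow_prime_eq_one_iff.mp h _ ?_
    rw [Perm.cycleType_eq l hprod hcyc hdisj]
    exact Multiset.mem_coe.mpr (List.mem_map_of_mem ht)
  refine ⟨l, fun t ht => Perm.card_support_eq_two.mp (hsupp t ht), hprod, ?_⟩
  rw [← hprod, Perm.card_support_prod_list_of_pairwise_disjoint hdisj,
    List.map_congr_left (f := Finset.card ∘ Perm.support) (g := fun _ => 2) hsupp]
  simp [mul_comm]

theorem two_mul_reflLen {w : W} (h : permEquiv cs w ^ 2 = 1) :
    2 * cs.reflLen w = (permEquiv cs w).support.card := by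
  obtain ⟨l, hl, hprod, hlen⟩ := exists_list_isSwap_of_sq_eq_one h
  have hmem : l.length ∈ {k | ∃ l : List W, l.length = k ∧ (∀ t ∈ l, cs.IsReflection t) ∧
      l.prod = w} := by
    refine ⟨l.map (permEquiv cs).symm, by simp, ?_, ?_⟩
    · simpa [isReflection_iff_isSwap] using hl
    · rw [← map_list_prod, hprod, MulEquiv.symm_apply_apply]
  apply le_antisymm
  · have : cs.reflLen w ≤ l.length := Nat.sInf_le hmem
    omega
  · obtain ⟨l', hlen', hl', rfl⟩ := Nat.sInf_mem ⟨_, hmem⟩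
    rw [reflLen, ← hlen', map_list_prod]
    refine (card_support_prod_le _ ?_).trans_eq (by rw [List.length_map])
    simpa [isReflection_iff_isSwap] using hl'

theorem isConj_of_card_support_eq {m : ℕ} {σ τ : Perm (Fin m)} (hσ : σ ^ 2 = 1) (hτ : τ ^ 2 = 1)
    (h : σ.support.card = τ.support.card) : IsConj σ τ := by
  have h1 := Perm.cycleType_of_pow_prime_eq_one hσ
  have h2 := Perm.cycleType_of_pow_prime_eq_one hτ
  rw [← Perm.sum_cycleType, ← Perm.sum_cycleType, h1, h2, Multiset.sum_replicate,
    Multiset.sum_replicate] at h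
  rw [Perm.isConj_iff_cycleType_eq, h1, h2]
  congr 1
  simpa using h

/-- A permutation reversing disjoint intervals of letters and fixing the others is an involution;
an interval of `m + 1` letters contains `2 * ⌈m / 2⌉` moved ones. -/
theorem sq_eq_one_and_card_support_of_reverses {r : ℕ} {a nn : Fin r → ℕ}
    (ha1 : ∀ j, 1 ≤ a j) (hend : ∀ j, a j + nn j ≤ n + 1)
    (hsep : ∀ j j' : Fin r, (j : ℕ) < (j' : ℕ) → a j + nn j + 1 ≤ a j')
    {σ : Perm (Fin (n + 1))}
    (hin : ∀ (x : Fin (n + 1)) j, InBlock (a j) (nn j) x → (σ x : ℕ) + x + 2 = 2 * a j + nn j)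
    (hout : ∀ x : Fin (n + 1), (∀ j, ¬ InBlock (a j) (nn j) x) → σ x = x) :
    σ ^ 2 = 1 ∧ σ.support.card = 2 * ∑ j, (nn j + 1) / 2 := by
  constructor
  · ext x
    rw [pow_two, Perm.mul_apply, Perm.one_apply]
    by_cases hx : ∃ j, InBlock (a j) (nn j) x
    · obtain ⟨j, hj⟩ := hx
      have h1 := hin x j hj
      have h2 := hin (σ x) j (by simp only [InBlock] at hj ⊢; omega)
      omega
    · rw [hout x (not_exists.mp hx), hout x (not_exists.mp hx)]
  · have key : σ.support.map Fin.valEmbedding = Finset.univ.biUnion fun j =>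
        Finset.Ico (a j - 1) (a j - 1 + (nn j + 1) / 2) ∪
          Finset.Ico (a j + nn j - (nn j + 1) / 2) (a j + nn j) := by
      ext y
      simp only [Finset.mem_map, Perm.mem_support, Fin.valEmbedding_apply, Finset.mem_biUnion,
        Finset.mem_univ, true_and, Finset.mem_union, Finset.mem_Ico]
      constructor
      · rintro ⟨x, hx, rfl⟩
        by_cases hb : ∃ j, InBlock (a j) (nn j) x
        · obtain ⟨j, hj⟩ := hb
          have h1 := hin x j hj
          have h2 : (σ x : ℕ) ≠ x := fun h => hx (Fin.ext h)
          have h3 := ha1 j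
          simp only [InBlock] at hj
          exact ⟨j, by omega⟩
        · exact absurd (hout x (not_exists.mp hb)) hx
      · rintro ⟨j, hj⟩
        have h1 := ha1 j
        have h2 := hend j
        refine ⟨⟨y, by omega⟩, fun h => ?_, rfl⟩
        have h3 := hin ⟨y, by omega⟩ j (by simp only [InBlock]; omega)
        rw [h] at h3
        simp only at h3
        omega
    rw [← Finset.card_map Fin.valEmbedding, key, Finset.card_biUnion, Finset.mul_sum]
    · refine Finset.sum_congr rfl fun j _ => ?_
      have := ha1 j
      rw [Finset.card_union_of_disjoint, Nat.card_Ico, Nat.card_Ico]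
      · omega
      · rw [Finset.disjoint_left]
        intro y
        simp only [Finset.mem_Ico]
        omega
    · intro j _ j' _ hne
      rw [Function.onFun_apply, Finset.disjoint_left]
      intro y
      simp only [Finset.mem_union, Finset.mem_Ico]
      have h1 := ha1 j
      have h2 := ha1 j'
      rcases lt_or_gt_of_ne (fun h => hne (Fin.ext h) : (j : ℕ) ≠ j') with hlt | hlt
      · have := hsep j j' hlt
        omega
      · have := hsep j' j hlt
        omega

/-- The product of the reversal of all letters and the reversal of a centred interval of letters
exchanges the `p` first letters with the `p` last ones. -/
theorem sq_eq_one_and_card_support_of_exchanges {p : ℕ} (hp : 2 * p ≤ n + 1)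
    {σ : Perm (Fin (n + 1))}
    (hσ : ∀ x : Fin (n + 1), (σ x : ℕ) = if (x : ℕ) < p ∨ n < x + p then n - x else (x : ℕ)) :
    σ ^ 2 = 1 ∧ σ.support.card = 2 * p := by
  constructor
  · ext x
    rw [pow_two, Perm.mul_apply, Perm.one_apply, hσ, hσ]
    grind
  · have key : σ.support.map Fin.valEmbedding = Finset.Ico 0 p ∪ Finset.Ico (n + 1 - p) (n + 1) := by
      ext y
      simp only [Finset.mem_map, Perm.mem_support, Fin.valEmbedding_apply, Finset.mem_union,
        Finset.mem_Ico, ne_eq, Fin.ext_iff, hσ]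
      constructor
      · rintro ⟨x, hx, rfl⟩
        grind
      · intro h
        exact ⟨⟨y, by omega⟩, by simp only; grind, rfl⟩
    rw [← Finset.card_map Fin.valEmbedding, key, Finset.card_union_of_disjoint, Nat.card_Ico,
      Nat.card_Ico]
    · omega
    · rw [Finset.disjoint_left]
      intro y
      simp only [Finset.mem_Ico]
      omega

theorem isConj_and_reflLen_longest
    {r : ℕ} {a nn : Fin r → ℕ} (ha1 : ∀ j, 1 ≤ a j) (hend : ∀ j, a j + nn j ≤ n + 1)
    (hsep : ∀ j j' : Fin r, (j : ℕ) < (j' : ℕ) → a j + nn j + 1 ≤ a j')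
    {J : Set (Fin n)}
    (hJ : J = {i : Fin n | ∃ j, a j ≤ (i : ℕ) + 1 ∧ (i : ℕ) + 1 < a j + nn j})
    {p : ℕ} (hp : p = ∑ j, (nn j + 1) / 2)
    {I : Set (Fin n)} (hI : I = {i : Fin n | p ≤ (i : ℕ) ∧ (i : ℕ) + 1 ≤ n - p})
    {w0 wJ wI : W} (hw0 : cs.IsLongestOf Set.univ w0)
    (hwJ : cs.IsLongestOf J wJ) (hwI : cs.IsLongestOf I wI) :
    IsConj wJ (w0 * wI) ∧ cs.reflLen w0 = cs.reflLen wJ + cs.reflLen wI := by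
  obtain ⟨hinJ, houtJ⟩ :=
    permEquiv_apply_of_isLongestOf cs ha1 hend hsep (fun i => by rw [hJ]; rfl) hwJ
  obtain ⟨hsqJ, hcardJ⟩ := sq_eq_one_and_card_support_of_reverses ha1 hend hsep hinJ houtJ
  have h2p : 2 * p ≤ n + 1 := by
    rw [hp, ← hcardJ]
    simpa using Finset.card_le_univ (permEquiv cs wJ).support
  have hsep1 : ∀ (m : ℕ) (b : Fin 1 → ℕ), ∀ j j' : Fin 1, (j : ℕ) < (j' : ℕ) → b j + m + 1 ≤ b j' :=
    fun _ _ j j' h => by omega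
  have hend0 : ∀ _ : Fin 1, 1 + n ≤ n + 1 := fun _ => by omega
  have hendI : ∀ _ : Fin 1, p + 1 + (n - 2 * p) ≤ n + 1 := fun _ => by omega
  obtain ⟨hin0, hout0⟩ := permEquiv_apply_of_isLongestOf cs (a := fun _ : Fin 1 => 1)
    (nn := fun _ => n) (fun _ => le_rfl) hend0 (hsep1 _ _)
    (fun i => by simp only [Set.mem_univ, true_iff]; exact ⟨0, by omega⟩) hw0
  obtain ⟨hinI, houtI⟩ := permEquiv_apply_of_isLongestOf cs (a := fun _ : Fin 1 => p + 1)
    (nn := fun _ => n - 2 * p) (fun _ => by omega) hendI (hsep1 _ _)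
    (fun i => by
      rw [hI, Set.mem_ofPred_eq]
      constructor
      · intro h
        exact ⟨0, by omega⟩
      · rintro ⟨-, h⟩
        omega) hwI
  obtain ⟨hsq0, hcard0⟩ := sq_eq_one_and_card_support_of_reverses (fun _ => le_rfl) hend0
    (hsep1 _ _) hin0 hout0
  obtain ⟨hsqI, hcardI⟩ := sq_eq_one_and_card_support_of_reverses (fun _ => by omega) hendI
    (hsep1 _ _) hinI houtI
  simp only [Finset.univ_unique, Finset.sum_const, Finset.card_singleton, one_smul]
    at hcard0 hcardI
  have hprod : ∀ x : Fin (n + 1), (permEquiv cs (w0 * wI) x : ℕ) =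
      if (x : ℕ) < p ∨ n < x + p then n - x else (x : ℕ) := by
    intro x
    rw [map_mul, Perm.mul_apply]
    have h0 := hin0 (permEquiv cs wI x) 0 (by simp only [InBlock]; omega)
    by_cases hx : InBlock (p + 1) (n - 2 * p) x
    · have h1 := hinI x 0 hx
      simp only [InBlock] at hx
      split_ifs <;> omega
    · have h1 := congrArg Fin.val (houtI x fun _ => hx)
      simp only [InBlock] at hx
      split_ifs <;> omega
  obtain ⟨hsqP, hcardP⟩ := sq_eq_one_and_card_support_of_exchanges h2p hprod
  constructor
  · have hconj := isConj_of_card_support_eq hsqJ hsqP (by rw [hcardJ, hcardP, hp])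
    simpa using (permEquiv cs).symm.toMonoidHom.map_isConj hconj
  · have e0 := two_mul_reflLen cs hsq0
    have eJ := two_mul_reflLen cs hsqJ
    have eI := two_mul_reflLen cs hsqI
    rw [← hp] at hcardJ
    omega

end CoxeterSystem.TypeA

/-- Let `W` be the Weyl group of type `Aₙ` (Bourbaki labelling: the simple reflection
`s_k`, `1 ≤ k ≤ n`, corresponds to the vertex `k − 1 : Fin n`) and let `J ⊆ S` be a
subset whose connected components, as subdiagrams of the Dynkin diagram, are the
intervals of labels `[a_j, a_j + n_j − 1]`, of types `A_{n_1}, …, A_{n_r}`. Set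
`p = Σⱼ ⌈n_j / 2⌉` and `I = {s_{p+1}, …, s_{n−p}}`. Then `w_J` is conjugate in `W` to
`w₀ w_I`, and `ℓ_R(w₀) = ℓ_R(w_J) + ℓ_R(w_I)`. -/
theorem stmt10 (n : ℕ) {W : Type*} [Group W]
    (cs : CoxeterSystem (CoxeterMatrix.Aₙ n) W)
    (r : ℕ) (a nn : Fin r → ℕ)
    (hnn : ∀ j, 0 < nn j) (ha1 : ∀ j, 1 ≤ a j) (hend : ∀ j, a j + nn j ≤ n + 1)
    (hsep : ∀ j j' : Fin r, (j : ℕ) < (j' : ℕ) → a j + nn j + 1 ≤ a j')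
    (J : Set (Fin n))
    (hJ : J = {i : Fin n | ∃ j, a j ≤ (i : ℕ) + 1 ∧ (i : ℕ) + 1 < a j + nn j})
    (p : ℕ) (hp : p = ∑ j, (nn j + 1) / 2)
    (I : Set (Fin n)) (hI : I = {i : Fin n | p ≤ (i : ℕ) ∧ (i : ℕ) + 1 ≤ n - p})
    (w0 wJ wI : W) (hw0 : cs.IsLongestOf Set.univ w0)
    (hwJ : cs.IsLongestOf J wJ) (hwI : cs.IsLongestOf I wI) :
    IsConj wJ (w0 * wI) ∧ cs.reflLen w0 = cs.reflLen wJ + cs.reflLen wI := by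
  exact CoxeterSystem.TypeA.isConj_and_reflLen_longest cs ha1 hend hsep hJ hp hI hw0 hwJ hwI
end
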